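/- arXiv:1910.11181 — 2 statements merged into one kernel-verified Lean document; each statement's English description precedes it below -/
import Mathlib

section
/- Let μ be a Borel probability measure on Cantor space 2^ω and let A ⊆ 2^ω. If for every s ∈ [0,1) the measure game G(s,A) is determined (i.e., one of the two players has a winning strategy), then A is μ-measurable. -/
open MeasureTheory

namespace MeasureGame

/-- Cantor space `2^ω`. -/
abbrev Cantor : Type := ℕ → Bool

/-- The basic cylinder set `N_t` determined by a finite binary string `t`. -/
def cyl (t : List Bool) : Set Cantor := {x | ∀ i : Fin t.length, x i.1 = t.get i}

/-- A round of the measure game: player I's pair of rationals, then player II's bit. -/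
abbrev GRound : Type := (ℚ × ℚ) × Bool

/-- A strategy for player I in the measure game. -/
abbrev StratI : Type := List GRound → ℚ × ℚ

/-- A strategy for player II in the measure game. -/
abbrev StratII : Type := List GRound → ℚ × ℚ → Bool

/-- A run of the measure game. -/
abbrev Run : Type := ℕ → GRound

/-- The history (list of completed rounds) before round `n`. -/
def hist (r : Run) (n : ℕ) : List GRound := (List.range n).map r

/-- Player II's bit at round `n`. -/
def bits (r : Run) (n : ℕ) : Bool := (r n).2

/-- The finite binary string of player II's first `n` bits. -/
def path (r : Run) (n : ℕ) : List Bool := (List.range n).map (bits r)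

/-- The value player I assigned at round `n` to the one-bit extension of the current path by `b`. -/
def valI (r : Run) (n : ℕ) (b : Bool) : ℚ := if b then (r n).1.2 else (r n).1.1

/-- The value selected by player II's move at round `n`. -/
def sel (r : Run) (n : ℕ) : ℚ := valI r n (bits r n)

/-- Legality requirements on the single value player I assigned to `path r n ++ [b]`:
it is nonnegative, at most `μ(N_{t⌢b})`, and strictly below it when the latter is positive. -/
def mOK (μ : Measure Cantor) (r : Run) (n : ℕ) (b : Bool) : Prop :=
  0 ≤ valI r n b ∧ ((valI r n b : ℝ) ≤ (μ (cyl (path r n ++ [b]))).toReal) ∧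
    (0 < (μ (cyl (path r n ++ [b]))).toReal → (valI r n b : ℝ) < (μ (cyl (path r n ++ [b]))).toReal)

/-- Player I's move at round `n` of a run is legal (for the game `G(s, ·)`). -/
def IOK (μ : Measure Cantor) (s : ℝ) (r : Run) : ℕ → Prop
  | 0 => mOK μ r 0 false ∧ mOK μ r 0 true ∧ s < ((r 0).1.1 : ℝ) + ((r 0).1.2 : ℝ)
  | (n + 1) => mOK μ r (n + 1) false ∧ mOK μ r (n + 1) true ∧
      (r (n + 1)).1.1 + (r (n + 1)).1.2 = sel r n

/-- Player II's move at round `n` of a run is legal: the selected value is nonzero. -/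
def IIOK (r : Run) (n : ℕ) : Prop := sel r n ≠ 0

/-- The run `r` is consistent with player I's strategy `σ`. -/
def ConsI (σ : StratI) (r : Run) : Prop := ∀ n, (r n).1 = σ (hist r n)

/-- The run `r` is consistent with player II's strategy `τ`. -/
def ConsII (τ : StratII) (r : Run) : Prop := ∀ n, (r n).2 = τ (hist r n) (r n).1

/-- Player II wins the run `r` of `G(s, A)`: either player I is the first to break a rule,
or all rules are followed and the sequence of II's bits belongs to `A`. -/
def IIWinsRun (μ : Measure Cantor) (s : ℝ) (A : Set Cantor) (r : Run) : Prop :=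
  (∃ n, (∀ m < n, IOK μ s r m ∧ IIOK r m) ∧ ¬ IOK μ s r n) ∨
    ((∀ n, IOK μ s r n ∧ IIOK r n) ∧ bits r ∈ A)

/-- Player I has a winning strategy in the measure game `G(s, A)`. -/
def WinsI (μ : Measure Cantor) (s : ℝ) (A : Set Cantor) : Prop :=
  ∃ σ : StratI, ∀ r : Run, ConsI σ r → ¬ IIWinsRun μ s A r

/-- Player II has a winning strategy in the measure game `G(s, A)`. -/
def WinsII (μ : Measure Cantor) (s : ℝ) (A : Set Cantor) : Prop :=
  ∃ τ : StratII, ∀ r : Run, ConsII τ r → IIWinsRun μ s A r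

/-- The outer measure `μ*(A) = inf {μ(U) : U open, A ⊆ U}`. -/
noncomputable def outerM (μ : Measure Cantor) (A : Set Cantor) : ℝ :=
  sInf {v : ℝ | ∃ U : Set Cantor, IsOpen U ∧ A ⊆ U ∧ v = (μ U).toReal}

/-- The inner measure `μ_*(A) = sup {μ(F) : F closed, F ⊆ A}`. -/
noncomputable def innerM (μ : Measure Cantor) (A : Set Cantor) : ℝ :=
  sSup {v : ℝ | ∃ F : Set Cantor, IsClosed F ∧ F ⊆ A ∧ v = (μ F).toReal}


section
open Set

theorem box_sub (n : ℕ → ℕ) (V : Set (ℕ → ℕ)) (hV : IsOpen V)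
    (h : {a : ℕ → ℕ | ∀ i, a i ≤ n i} ⊆ V) :
    ∃ k, {a : ℕ → ℕ | ∀ i < k, a i ≤ n i} ⊆ V := by
  by_contra hcon
  push Not at hcon
  have hc : ∀ k, ∃ a : ℕ → ℕ, (∀ i < k, a i ≤ n i) ∧ a ∉ V := by
    intro k
    obtain ⟨a, ha, hb⟩ := Set.not_subset.1 (hcon k)
    exact ⟨a, ha, hb⟩
  choose a ha hav using hc
  have hcomp : IsCompact {a : ℕ → ℕ | ∀ i, a i ≤ n i} := by
    have := isCompact_univ_pi (X := fun _ : ℕ => ℕ) (s := fun i => Set.Iic (n i))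
      (fun i => (Set.finite_Iic (n i)).isCompact)
    convert this using 1
    ext x; simp [Pi.le_def]
  obtain ⟨z, hz, φ, hφ, hlim⟩ := hcomp.tendsto_subseq (x := fun k i => min (a k i) (n i))
    (fun k i => min_le_right _ _)
  have hlim2 : Filter.Tendsto (fun k => a (φ k)) Filter.atTop (nhds z) := by
    rw [tendsto_pi_nhds] at hlim ⊢
    intro i
    refine (hlim i).congr' ?_
    filter_upwards [Filter.eventually_gt_atTop i] with k hk
    have : i < φ k := lt_of_lt_of_le hk (hφ.id_le k)
    simpa using ha (φ k) i this
  have := hlim2.eventually (hV.mem_nhds (h hz))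
  obtain ⟨k, hk⟩ := this.exists
  exact hav _ hk

theorem capac {X : Type*} [TopologicalSpace X] [MeasurableSpace X] (μ : Measure X)
    [μ.OuterRegular] (S : Set (ℕ → ℕ)) (hS : IsClosed S) (f : (ℕ → ℕ) → X) (hf : Continuous f)
    (c : ENNReal) (hc : c < μ (f '' S)) : ∃ K, IsCompact K ∧ K ⊆ f '' S ∧ c ≤ μ K := by
  have step : ∀ T : Set (ℕ → ℕ), c < μ (f '' T) → ∀ k, ∃ m, c < μ (f '' (T ∩ {a | a k ≤ m})) := by
    intro T hT k
    have hm : Monotone fun m => f '' (T ∩ {a | a k ≤ m}) := by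
      intro m m' h
      exact image_mono (inter_subset_inter_right _ fun a (ha : a k ≤ m) => le_trans ha h)
    have hU : f '' T = ⋃ m, f '' (T ∩ {a | a k ≤ m}) := by
      rw [← image_iUnion, ← inter_iUnion]
      congr 1
      ext a
      simp only [mem_inter_iff, mem_iUnion, mem_ofPred_eq]
      exact ⟨fun h => ⟨h, _, le_rfl⟩, fun h => h.1⟩
    rw [hU, hm.measure_iUnion] at hT
    exact lt_iSup_iff.1 hT
  choose! g hg using step
  let T : ℕ → Set (ℕ → ℕ) := fun k => Nat.rec S (fun k T => T ∩ {a | a k ≤ g T k}) k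
  have hT : ∀ k, c < μ (f '' T k) := by
    intro k
    induction k with
    | zero => exact hc
    | succ k ih => exact hg _ ih k
  let n : ℕ → ℕ := fun k => g (T k) k
  have hTn : ∀ k, T k ⊆ S ∩ {a | ∀ i < k, a i ≤ n i} := by
    intro k
    induction k with
    | zero => intro a ha; exact ⟨ha, by simp⟩
    | succ k ih =>
      rintro a ⟨h1, h2⟩
      refine ⟨(ih h1).1, fun i hi => ?_⟩
      rcases Nat.lt_succ_iff_lt_or_eq.1 hi with h | rfl
      · exact (ih h1).2 i h
      · exact h2
  have hcomp : IsCompact {a : ℕ → ℕ | ∀ i, a i ≤ n i} := by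
    have := isCompact_univ_pi (X := fun _ : ℕ => ℕ) (s := fun i => Set.Iic (n i))
      (fun i => (Set.finite_Iic (n i)).isCompact)
    convert this using 1
    ext x; simp [Pi.le_def]
  refine ⟨f '' (S ∩ {a | ∀ i, a i ≤ n i}), (hcomp.inter_left hS).image hf,
    image_mono inter_subset_left, ?_⟩
  rw [Set.measure_eq_iInf_isOpen]
  refine le_iInf fun U => le_iInf fun hU => le_iInf fun hUo => ?_
  obtain ⟨k, hk⟩ := box_sub n (f ⁻¹' U ∪ Sᶜ) ((hUo.preimage hf).union hS.isOpen_compl) (by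
    intro a ha
    by_cases h : a ∈ S
    · exact Or.inl (hU ⟨a, ⟨h, ha⟩, rfl⟩)
    · exact Or.inr h)
  refine (hT k).le.trans (measure_mono ?_)
  rintro _ ⟨a, ha, rfl⟩
  obtain ⟨h1, h2⟩ := hTn k ha
  rcases hk h2 with h | h
  · exact h
  · exact absurd h1 h

end

/-! generic plays -/

def playH (σ : StratI) (τ : StratII) : ℕ → List GRound
  | 0 => []
  | n + 1 => playH σ τ n ++ [(σ (playH σ τ n), τ (playH σ τ n) (σ (playH σ τ n)))]

def play (σ : StratI) (τ : StratII) : Run :=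
  fun n => (σ (playH σ τ n), τ (playH σ τ n) (σ (playH σ τ n)))

theorem hist_succ (r : Run) (n : ℕ) : hist r (n + 1) = hist r n ++ [r n] := by
  simp [hist, List.range_succ]

theorem path_succ (r : Run) (n : ℕ) : path r (n + 1) = path r n ++ [bits r n] := by
  simp [path, List.range_succ]

theorem hist_play (σ : StratI) (τ : StratII) (n : ℕ) : hist (play σ τ) n = playH σ τ n := by
  induction n with
  | zero => simp [hist, playH]
  | succ n ih => rw [hist_succ, ih]; rfl

theorem consI_play (σ : StratI) (τ : StratII) : ConsI σ (play σ τ) := by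
  intro n; rw [hist_play]; rfl

theorem consII_play (σ : StratI) (τ : StratII) : ConsII τ (play σ τ) := by
  intro n; rw [hist_play]; rfl

theorem hist_congr {r r' : Run} {n : ℕ} (h : ∀ i < n, r i = r' i) : hist r n = hist r' n := by
  unfold hist
  apply List.map_congr_left
  intro i hi
  exact h i (List.mem_range.1 hi)

theorem path_congr {r r' : Run} {n : ℕ} (h : ∀ i < n, r i = r' i) : path r n = path r' n := by
  unfold path
  apply List.map_congr_left
  intro i hi
  simp [bits, h i (List.mem_range.1 hi)]

theorem sel_congr {r r' : Run} {n : ℕ} (h : r n = r' n) : sel r n = sel r' n := by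
  have hb : bits r n = bits r' n := by simp only [bits, h]
  simp only [sel, valI, hb, h]

theorem mOK_congr {μ : Measure Cantor} {r r' : Run} {n : ℕ} (h : ∀ i ≤ n, r i = r' i) (b : Bool) :
    mOK μ r n b ↔ mOK μ r' n b := by
  simp only [mOK, valI, path_congr (fun i hi => h i (le_of_lt hi)), h n le_rfl]

theorem IOK_congr {μ : Measure Cantor} {s : ℝ} {r r' : Run} {n : ℕ} (h : ∀ i ≤ n, r i = r' i) :
    IOK μ s r n ↔ IOK μ s r' n := by
  cases n with
  | zero => simp only [IOK, mOK_congr h, h 0 le_rfl]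
  | succ n => simp only [IOK, mOK_congr h, h (n+1) le_rfl, sel_congr (h n (Nat.le_succ n))]

def CC (n : ℕ) (x : Cantor) : Set Cantor := {y | ∀ i < n, y i = x i}

theorem cyl_path (r : Run) (n : ℕ) : cyl (path r n) = CC n (bits r) := by
  ext y
  have hl : (path r n).length = n := by simp [path]
  constructor
  · intro h i hi
    have := h ⟨i, by rw [hl]; exact hi⟩
    simpa [path] using this
  · intro h i
    have := h i.1 (by have := i.2; omega)
    rw [this, List.get_eq_getElem]; simp [path]

theorem CC_congr {n : ℕ} {x y : Cantor} (h : ∀ i < n, x i = y i) : CC n x = CC n y := by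
  ext z
  exact ⟨fun hz i hi => (hz i hi).trans (h i hi), fun hz i hi => (hz i hi).trans (h i hi).symm⟩

theorem cyl_path_append (r : Run) (n : ℕ) (b : Bool) :
    cyl (path r n ++ [b]) = CC (n + 1) (Function.update (bits r) n b) := by
  let r' : Run := Function.update r n ((r n).1, b)
  have h1 : path r n = path r' n := path_congr fun i hi => by
    simp [r', Function.update_of_ne (ne_of_lt hi)]
  have h2 : bits r' = Function.update (bits r) n b := by
    funext i
    by_cases hi : i = n
    · subst hi; simp [r', bits]
    · simp [r', bits, hi]
  have h3 : b = bits r' n := by rw [h2]; simp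
  rw [h1, ← h2, ← cyl_path, path_succ, ← h3]

theorem isClopen_of_dep {Y : Type*} [TopologicalSpace Y] [DiscreteTopology Y] (n : ℕ)
    (P : (ℕ → Y) → Prop)
    (h : ∀ a b : ℕ → Y, (∀ i < n, a i = b i) → (P a ↔ P b)) : IsClopen {a | P a} := by
  let g : (ℕ → Y) → (Fin n → Y) := fun a i => a i
  have hg : Continuous g := by fun_prop
  have : {a | P a} = g ⁻¹' (g '' {a | P a}) := by
    apply Set.Subset.antisymm (Set.subset_preimage_image _ _)
    rintro a ⟨b, hb, hab⟩
    exact (h b a fun i hi => congrFun hab ⟨i, hi⟩).1 hb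
  rw [this]
  exact (isClopen_discrete _).preimage hg

theorem CC_clopen (n : ℕ) (x : Cantor) : IsClopen (CC n x) := by
  apply isClopen_of_dep n
  intro a b h
  exact forall₂_congr fun i hi => by rw [h i hi]

theorem CC_split (μ : Measure Cantor) [IsProbabilityMeasure μ] (G : Set Cantor) (k : ℕ)
    (x : Cantor) : μ.real (G ∩ CC k x) =
      μ.real (G ∩ CC (k+1) (Function.update x k false)) +
      μ.real (G ∩ CC (k+1) (Function.update x k true)) := by
  have key : ∀ b, G ∩ CC (k+1) (Function.update x k b) = (G ∩ CC k x) ∩ {y | y k = b} := by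
    intro b
    ext y
    constructor
    · rintro ⟨h1, h2⟩
      refine ⟨⟨h1, fun i hi => ?_⟩, ?_⟩
      · have := h2 i (by omega)
        rwa [Function.update_of_ne (by omega)] at this
      · have := h2 k (by omega)
        simpa using this
    · rintro ⟨⟨h1, h2⟩, h3⟩
      refine ⟨h1, fun i hi => ?_⟩
      by_cases hik : i = k
      · subst hik; simpa using h3
      · rw [Function.update_of_ne hik]; exact h2 i (by omega)
  have hm : MeasurableSet {y : Cantor | y k = false} :=
    (measurableSet_singleton false).preimage (measurable_pi_apply k)
  rw [key, key, ← measureReal_inter_add_sdiff (s := G ∩ CC k x) hm]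
  congr 2
  ext y
  simp

/-! player I wins -/

theorem caseI (μ : Measure Cantor) [IsProbabilityMeasure μ] (A : Set Cantor) (s : ℝ)
    (hw : WinsI μ s A) : ∃ F : Set Cantor, IsClosed F ∧ F ∩ A = ∅ ∧ s ≤ μ.real F := by
  obtain ⟨σ, hσ⟩ := hw
  let R : Cantor → Run := fun x => play σ (fun h _ => x h.length)
  have hlen : ∀ (τ : StratII) n, (playH σ τ n).length = n := by
    intro τ n
    induction n with
    | zero => rfl
    | succ n ih => simp [playH, ih]
  have hb : ∀ x, bits (R x) = x := by
    intro x; funext n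
    simp [bits, R, play, hlen]
  have hH : ∀ (n : ℕ) (x y : Cantor), (∀ i < n, x i = y i) →
      playH σ (fun h _ => x h.length) n = playH σ (fun h _ => y h.length) n := by
    intro n x y
    induction n with
    | zero => intro _; rfl
    | succ n ih =>
      intro h
      have := ih (fun i hi => h i (by omega))
      simp only [playH, this, hlen, h n (by omega)]
  have hR1 : ∀ (n : ℕ) (x y : Cantor), (∀ i < n, x i = y i) → (R x n).1 = (R y n).1 := by
    intro n x y h
    simp only [R, play, hH n x y h]
  have hR : ∀ (n : ℕ) (x y : Cantor), (∀ i ≤ n, x i = y i) → R x n = R y n := by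
    intro n x y h
    simp only [R, play, hH n x y (fun i hi => h i hi.le), hlen, h n le_rfl]
  let Fn : ℕ → Set Cantor := fun n => {x | ∀ m < n, sel (R x) m ≠ 0}
  have hFdep : ∀ (n : ℕ) (x y : Cantor), (∀ i < n, x i = y i) → (x ∈ Fn n ↔ y ∈ Fn n) := by
    intro n x y h
    refine forall₂_congr fun m hm => ?_
    rw [sel_congr (hR m x y fun i hi => h i (by omega))]
  have hFc : ∀ n, IsClopen (Fn n) := fun n => isClopen_of_dep n _ (hFdep n)
  have hI : ∀ n x, x ∈ Fn n → ∀ m ≤ n, IOK μ s (R x) m := by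
    intro n x hx m
    induction m using Nat.strong_induction_on with
    | _ m ih =>
      intro hm
      by_contra hcon
      exact hσ (R x) (consI_play _ _) (Or.inl ⟨m, fun i hi =>
        ⟨ih i hi (by omega), hx i (by omega)⟩, hcon⟩)
  have hmok : ∀ n x, x ∈ Fn n → ∀ b, mOK μ (R x) n b := by
    intro n x hx b
    have := hI n x hx n le_rfl
    cases n <;> cases b <;> simp only [IOK] at this <;> tauto
  have hsel : ∀ n x b, sel (R (Function.update x n b)) n = valI (R x) n b := by
    intro n x b
    simp only [sel, hb, valI, Function.update_self]
    rw [hR1 n (Function.update x n b) x fun i hi => Function.update_of_ne (by omega) _ _]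
  have hFn_succ : ∀ n x, x ∈ Fn n → sel (R x) n ≠ 0 → x ∈ Fn (n+1) := by
    intro n x h1 h2 m hm
    rcases Nat.lt_succ_iff_lt_or_eq.1 hm with h | rfl
    · exact h1 m h
    · exact h2
  have main : ∀ n k x, x ∈ Fn k → ((sel (R x) k : ℚ) : ℝ) ≤ μ.real (Fn (k+1+n) ∩ CC (k+1) x) := by
    intro n
    induction n with
    | zero =>
      intro k x hx
      by_cases h0 : sel (R x) k = 0
      · rw [h0]; simp
      have hx' := hFn_succ k x hx h0
      have hsub : CC (k+1) x ⊆ Fn (k+1) := fun y hy => (hFdep (k+1) y x hy).2 hx'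
      have := (hmok k x hx (x k)).2.1
      rw [cyl_path_append, hb, Function.update_eq_self] at this
      rw [add_zero, Set.inter_eq_right.2 hsub]
      simpa [sel, hb, Measure.real] using this
    | succ n ih =>
      intro k x hx
      by_cases h0 : sel (R x) k = 0
      · rw [h0]; simp
      have hx' := hFn_succ k x hx h0
      have hio := (hI (k+1) x hx' (k+1) le_rfl).2.2
      have hu : ∀ b, Function.update x (k+1) b ∈ Fn (k+1) := fun b =>
        (hFdep (k+1) _ x fun i hi => Function.update_of_ne (by omega) _ _).2 hx'
      have e1 := ih (k+1) _ (hu false)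
      have e2 := ih (k+1) _ (hu true)
      rw [hsel] at e1 e2
      rw [CC_split, ← hio, show k + 1 + (n + 1) = k + 1 + 1 + n by omega]
      push_cast
      simp only [valI] at e1 e2
      simpa using add_le_add e1 e2
  have top : ∀ n, s ≤ μ.real (Fn (n+1)) := by
    intro n
    let x : Cantor := fun _ => false
    have h0 : ∀ y, y ∈ Fn 0 := fun y m hm => absurd hm (Nat.not_lt_zero m)
    have e1 := main n 0 (Function.update x 0 false) (h0 _)
    have e2 := main n 0 (Function.update x 0 true) (h0 _)
    rw [hsel] at e1 e2
    have hio := (hI 0 x (h0 x) 0 le_rfl).2.2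
    have := CC_split μ (Fn (0+1+n)) 0 x
    have hC : CC 0 x = Set.univ := by ext; simp [CC]
    rw [hC, Set.inter_univ] at this
    simp only [valI] at e1 e2
    rw [show n + 1 = 0 + 1 + n by omega, this]
    refine hio.le.trans ?_
    simpa using add_le_add e1 e2
  refine ⟨⋂ n, Fn n, isClosed_iInter fun n => (hFc n).1, ?_, ?_⟩
  · ext x
    simp only [Set.mem_inter_iff, Set.mem_iInter, Set.mem_empty_iff_false, iff_false, not_and]
    intro hx hA
    refine hσ (R x) (consI_play _ _) (Or.inr ⟨fun n => ⟨hI n x (hx n) n le_rfl,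
      hx (n+1) n (by omega)⟩, ?_⟩)
    rwa [hb]
  · have ht : Filter.Tendsto (fun n => μ (Fn n)) Filter.atTop (nhds (μ (⋂ n, Fn n))) := by
      apply tendsto_measure_iInter_atTop
      · exact fun n => (hFc n).1.measurableSet.nullMeasurableSet
      · intro m n hmn x hx i hi
        exact hx i (by omega)
      · exact ⟨0, measure_ne_top _ _⟩
    have ht2 := (ENNReal.tendsto_toReal (measure_ne_top μ (⋂ n, Fn n))).comp ht
    refine ge_of_tendsto ht2 ?_
    filter_upwards [Filter.eventually_ge_atTop 1] with n hn
    obtain ⟨m, rfl⟩ : ∃ m, n = m + 1 := ⟨n - 1, by omega⟩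
    exact top m

/-! player II wins -/

theorem split_exists (m : ℚ) (a b : ℝ) (ha : 0 ≤ a) (hb : 0 ≤ b) (hm : 0 ≤ m)
    (h : (m : ℝ) < a + b ∨ m = 0) : ∃ p : ℚ × ℚ, p.1 + p.2 = m ∧ 0 ≤ p.1 ∧ 0 ≤ p.2 ∧
      ((p.1 : ℝ) < a ∨ p.1 = 0) ∧ ((p.2 : ℝ) < b ∨ p.2 = 0) := by
  rcases hm.eq_or_lt with h0 | h0
  · exact ⟨(0, 0), by simp [← h0], by simp⟩
  have h1 : (m : ℝ) < a + b := h.resolve_right h0.ne'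
  rcases ha.eq_or_lt with ha0 | ha0
  · exact ⟨(0, m), by simp, by simp, hm, by simp, Or.inl (by simpa [← ha0] using h1)⟩
  rcases hb.eq_or_lt with hb0 | hb0
  · exact ⟨(m, 0), by simp, hm, by simp, Or.inl (by simpa [← hb0] using h1), by simp⟩
  have hmr : (0 : ℝ) < m := by exact_mod_cast h0
  obtain ⟨p, hp1, hp2⟩ := exists_rat_btwn (show max ((m : ℝ) - b) 0 < min a m by
    rw [max_lt_iff, lt_min_iff, lt_min_iff]
    exact ⟨⟨by linarith, by linarith⟩, ha0, hmr⟩)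
  rw [max_lt_iff] at hp1
  rw [lt_min_iff] at hp2
  refine ⟨(p, m - p), by simp, ?_, ?_, Or.inl hp2.1, Or.inl ?_⟩
  · exact_mod_cast hp1.2.le
  · have : p < m := by exact_mod_cast hp2.2
    simpa using this.le
  · push_cast; linarith [hp1.1]

def lastVal (q : ℚ) (h : List GRound) : ℚ :=
  match h.getLast? with
  | none => q
  | some g => if g.2 then g.1.2 else g.1.1

theorem caseII_aux (μ : Measure Cantor) [IsProbabilityMeasure μ] (A : Set Cantor) (s : ℝ)
    (hs : 0 ≤ s) (τ : StratII) (hτ : ∀ r : Run, ConsII τ r → IIWinsRun μ s A r)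
    (K : Set Cantor) (hK : IsClosed K) (hsK : s < μ.real K) :
    ∃ r : Run, (ConsII τ r ∧ ∀ n, IOK μ s r n ∧ IIOK r n) ∧ bits r ∈ K := by
  obtain ⟨q, hq1, hq2⟩ := exists_rat_btwn hsK
  have hsp : ∀ (m : ℚ) (a b : ℝ), ∃ p : ℚ × ℚ, 0 ≤ a → 0 ≤ b → 0 ≤ m →
    ((m : ℝ) < a + b ∨ m = 0) → p.1 + p.2 = m ∧ 0 ≤ p.1 ∧ 0 ≤ p.2 ∧
      ((p.1 : ℝ) < a ∨ p.1 = 0) ∧ ((p.2 : ℝ) < b ∨ p.2 = 0) := by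
    intro m a b
    by_cases h : 0 ≤ a ∧ 0 ≤ b ∧ 0 ≤ m ∧ ((m : ℝ) < a + b ∨ m = 0)
    · obtain ⟨p, hp⟩ := split_exists m a b h.1 h.2.1 h.2.2.1 h.2.2.2
      exact ⟨p, fun _ _ _ _ => hp⟩
    · exact ⟨(0, 0), fun h1 h2 h3 h4 => absurd ⟨h1, h2, h3, h4⟩ h⟩
  choose sp hspp using hsp
  let σ : StratI := fun h => sp (lastVal q h)
    (μ.real (K ∩ cyl (h.map Prod.snd ++ [false]))) (μ.real (K ∩ cyl (h.map Prod.snd ++ [true])))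
  let r := play σ τ
  have hpath : ∀ n, (hist r n).map Prod.snd = path r n := by
    intro n
    simp [hist, path, bits, Function.comp_def]
  have hlast : ∀ n, lastVal q (hist r (n+1)) = sel r n := by
    intro n
    rw [hist_succ]
    simp [lastVal, sel, valI, bits]
    rfl
  have hr : ∀ n, (r n).1 = sp (lastVal q (hist r n)) (μ.real (K ∩ cyl (path r n ++ [false])))
      (μ.real (K ∩ cyl (path r n ++ [true]))) := by
    intro n
    rw [← hpath]
    exact consI_play σ τ n
  have hsum : ∀ n, μ.real (K ∩ cyl (path r n)) = μ.real (K ∩ cyl (path r n ++ [false])) +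
      μ.real (K ∩ cyl (path r n ++ [true])) := by
    intro n
    rw [cyl_path_append, cyl_path_append, cyl_path, CC_split]
  have step : ∀ n, (0 ≤ lastVal q (hist r n) ∧
      ((lastVal q (hist r n) : ℝ) < μ.real (K ∩ cyl (path r n)) ∨ lastVal q (hist r n) = 0)) →
      (r n).1.1 + (r n).1.2 = lastVal q (hist r n) ∧ ∀ b, 0 ≤ valI r n b ∧
       ((valI r n b : ℝ) < μ.real (K ∩ cyl (path r n ++ [b])) ∨ valI r n b = 0) := by
    intro n hn
    rw [hsum] at hn
    have := hspp _ _ _ measureReal_nonneg measureReal_nonneg hn.1 hn.2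
    rw [← hr] at this
    refine ⟨this.1, fun b => ?_⟩
    cases b <;> simp only [valI] <;> simp <;> tauto
  have inv : ∀ n, (0 ≤ lastVal q (hist r n) ∧
      ((lastVal q (hist r n) : ℝ) < μ.real (K ∩ cyl (path r n)) ∨ lastVal q (hist r n) = 0)) := by
    intro n
    induction n with
    | zero =>
      have h1 : lastVal q (hist r 0) = q := by simp [lastVal, hist]
      have h2 : cyl (path r 0) = Set.univ := by rw [cyl_path]; ext; simp [CC]
      rw [h1, h2, Set.inter_univ]
      refine ⟨?_, Or.inl hq2⟩
      have : (0 : ℝ) ≤ q := by linarith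
      exact_mod_cast this
    | succ n ih =>
      rw [hlast, path_succ]
      exact (step n ih).2 (bits r n)
  have hmok : ∀ n b, mOK μ r n b := by
    intro n b
    obtain ⟨h1, h2⟩ := (step n (inv n)).2 b
    have hle : μ.real (K ∩ cyl (path r n ++ [b])) ≤ μ.real (cyl (path r n ++ [b])) :=
      measureReal_mono Set.inter_subset_right
    have hnn : 0 ≤ μ.real (cyl (path r n ++ [b])) := measureReal_nonneg
    change _ ∧ _ ≤ μ.real _ ∧ (0 < μ.real _ → _ < μ.real _)
    rcases h2 with h2 | h2
    · exact ⟨h1, by linarith, fun _ => by linarith⟩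
    · rw [h2]; simpa using hnn
  have hio : ∀ n, IOK μ s r n := by
    intro n
    have h := (step n (inv n)).1
    cases n with
    | zero =>
      refine ⟨hmok _ _, hmok _ _, ?_⟩
      have h1 : lastVal q (hist r 0) = q := by simp [lastVal, hist]
      rw [h1] at h
      have h' : ((r 0).1.1 : ℝ) + ((r 0).1.2 : ℝ) = q := by exact_mod_cast h
      rw [h']; exact hq1
    | succ n =>
      refine ⟨hmok _ _, hmok _ _, ?_⟩
      rw [h, hlast]
  have hcons : ConsII τ r := consII_play σ τ
  have hleg : ∀ n, IOK μ s r n ∧ IIOK r n := by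
    rcases hτ r hcons with ⟨n, _, hn⟩ | h
    · exact absurd (hio n) hn
    · exact h.1
  refine ⟨r, ⟨hcons, hleg⟩, ?_⟩
  have hne : ∀ n, ∃ y ∈ K, ∀ i < n + 1, y i = bits r i := by
    intro n
    obtain ⟨h1, h2⟩ := inv (n+1)
    rw [hlast] at h1 h2
    have h3 := h2.resolve_right (hleg n).2
    have h4 : 0 < μ.real (K ∩ cyl (path r (n+1))) := lt_of_le_of_lt (by exact_mod_cast h1) h3
    have h5 : (K ∩ cyl (path r (n+1))).Nonempty := by
      by_contra hcon
      rw [Set.not_nonempty_iff_eq_empty] at hcon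
      rw [hcon] at h4
      simp at h4
    obtain ⟨y, hy1, hy2⟩ := h5
    rw [cyl_path] at hy2
    exact ⟨y, hy1, hy2⟩
  choose y hy1 hy2 using hne
  refine hK.mem_of_tendsto (b := Filter.atTop) (f := y) ?_ (Filter.Eventually.of_forall hy1)
  rw [tendsto_pi_nhds]
  intro i
  refine tendsto_const_nhds.congr' ?_
  filter_upwards [Filter.eventually_ge_atTop i] with n hn
  exact (hy2 n i (by omega)).symm

theorem caseII (μ : Measure Cantor) [IsProbabilityMeasure μ] (A : Set Cantor) (s : ℝ)
    (hs : 0 ≤ s) (hw : WinsII μ s A) (c : ℝ) (hc : c < 1 - s) :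
    ∃ F : Set Cantor, IsClosed F ∧ F ⊆ A ∧ c ≤ μ.real F := by
  obtain ⟨τ, hτ⟩ := hw
  by_cases hc0 : c < 0
  · exact ⟨∅, isClosed_empty, Set.empty_subset _, by simpa using hc0.le⟩
  push Not at hc0
  obtain ⟨e, he⟩ := exists_surjective_nat GRound
  let S : Set (ℕ → ℕ) := {a | ConsII τ (e ∘ a) ∧ ∀ n, IOK μ s (e ∘ a) n ∧ IIOK (e ∘ a) n}
  let f : (ℕ → ℕ) → Cantor := fun a => bits (e ∘ a)
  have hf : Continuous f := by
    refine continuous_pi fun n => ?_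
    exact (continuous_of_discreteTopology (f := fun k : ℕ => (e k).2)).comp (continuous_apply n)
  have hS : IsClosed S := by
    have : S = ⋂ n, {a | ((e (a n)).2 = τ (hist (e ∘ a) n) (e (a n)).1) ∧
        IOK μ s (e ∘ a) n ∧ IIOK (e ∘ a) n} := by
      ext a
      simp only [S, Set.mem_iInter, Set.mem_ofPred_eq, ConsII, Function.comp]
      exact forall_and.symm
    rw [this]
    refine isClosed_iInter fun n => (isClopen_of_dep (n+1) _ ?_).1
    intro a b h
    have h' : ∀ i ≤ n, (e ∘ a) i = (e ∘ b) i := fun i hi => by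
      simp [h i (by omega)]
    rw [IOK_congr h', hist_congr (fun i hi => h' i hi.le), h n (by omega)]
    unfold IIOK
    rw [sel_congr (h' n le_rfl)]
  have hW : ∀ r : Run, (ConsII τ r ∧ ∀ n, IOK μ s r n ∧ IIOK r n) → bits r ∈ f '' S := by
    intro r hr
    choose a ha using fun n => he (r n)
    have : e ∘ a = r := funext ha
    exact ⟨a, by simpa only [S, Set.mem_ofPred_eq, this] using hr, by simp only [f, this]⟩
  have hWA : f '' S ⊆ A := by
    rintro _ ⟨a, ha, rfl⟩
    rcases hτ _ ha.1 with ⟨n, _, hn⟩ | h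
    · exact absurd (ha.2 n).1 hn
    · exact h.2
  have hlt : ENNReal.ofReal c < μ (f '' S) := by
    by_contra hcon
    push Not at hcon
    obtain ⟨U, hU, hUo, hUm⟩ := Set.exists_isOpen_lt_of_lt (μ := μ) (f '' S) (ENNReal.ofReal (1 - s))
      (lt_of_le_of_lt hcon ((ENNReal.ofReal_lt_ofReal_iff (by linarith)).2 hc))
    have h1 : μ.real U < 1 - s := by
      have := (ENNReal.toReal_lt_toReal (measure_ne_top _ _) ENNReal.ofReal_ne_top).2 hUm
      rwa [ENNReal.toReal_ofReal (by linarith)] at this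
    obtain ⟨r, hr, hrK⟩ := caseII_aux μ A s hs τ hτ Uᶜ hUo.isClosed_compl (by
      rw [probReal_compl_eq_one_sub hUo.measurableSet]; linarith)
    exact hrK (hU (hW r hr))
  obtain ⟨K, hK, hKS, hKc⟩ := capac μ S hS f hf _ hlt
  refine ⟨K, hK.isClosed, hKS.trans hWA, ?_⟩
  have := ENNReal.toReal_mono (measure_ne_top μ K) hKc
  rwa [ENNReal.toReal_ofReal hc0] at this

/-- If the measure game `G(s, A)` is determined for every `s ∈ [0,1)`, then `A` is
`μ`-measurable, i.e. its outer and inner measures coincide. -/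
theorem measurable_of_game_determined (μ : Measure Cantor) [IsProbabilityMeasure μ]
    (A : Set Cantor) (hdet : ∀ s : ℝ, 0 ≤ s → s < 1 → WinsI μ s A ∨ WinsII μ s A) :
    outerM μ A = innerM μ A := by
  have bO : BddBelow {v : ℝ | ∃ U : Set Cantor, IsOpen U ∧ A ⊆ U ∧ v = (μ U).toReal} :=
    ⟨0, by rintro _ ⟨U, _, _, rfl⟩; exact ENNReal.toReal_nonneg⟩
  have bI : BddAbove {v : ℝ | ∃ F : Set Cantor, IsClosed F ∧ F ⊆ A ∧ v = (μ F).toReal} :=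
    ⟨1, by rintro _ ⟨U, _, _, rfl⟩; exact measureReal_le_one⟩
  have o1 : outerM μ A ≤ 1 :=
    csInf_le bO ⟨Set.univ, isOpen_univ, Set.subset_univ _, by simp⟩
  have i0 : 0 ≤ innerM μ A :=
    le_csSup bI ⟨∅, isClosed_empty, Set.empty_subset _, by simp⟩
  apply le_antisymm
  · by_contra hcon
    push Not at hcon
    obtain ⟨c, hc1, hc2⟩ := exists_between hcon
    obtain ⟨d, hd1, hd2⟩ := exists_between hc2
    rcases hdet (1 - d) (by linarith) (by linarith) with h | h
    · obtain ⟨F, hF, hFA, hFm⟩ := caseI μ A _ h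
      have : outerM μ A ≤ μ.real Fᶜ := csInf_le bO ⟨Fᶜ, hF.isOpen_compl,
        fun x hx hxF => (Set.eq_empty_iff_forall_notMem.1 hFA x) ⟨hxF, hx⟩, rfl⟩
      rw [probReal_compl_eq_one_sub hF.measurableSet] at this
      linarith
    · obtain ⟨F, hF, hFA, hFm⟩ := caseII μ A _ (by linarith) h c (by linarith)
      have : μ.real F ≤ innerM μ A := le_csSup bI ⟨F, hF, hFA, rfl⟩
      linarith
  · refine csSup_le ⟨_, ∅, isClosed_empty, Set.empty_subset _, rfl⟩ ?_
    rintro _ ⟨F, _, hF, rfl⟩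
    refine le_csInf ⟨_, Set.univ, isOpen_univ, Set.subset_univ _, rfl⟩ ?_
    rintro _ ⟨U, _, hU, rfl⟩
    exact measureReal_mono (hF.trans hU)

end MeasureGame
end

section
/- (Continuous uniformization on a set of large measure.) Let R ⊆ 2^ω × ω^ω be such that for every x ∈ 2^ω there exists y ∈ ω^ω with (x,y) ∈ R, and suppose the unfolded measure game G_unfolded(0, R) is determined (i.e., one of the two players has a winning strategy). Then for every ε > 0 there exists a closed set A ⊆ 2^ω with μ(A) > 1 − ε and a continuous function f : A → ω^ω such that (x, f(x)) ∈ R for all x ∈ A. -/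
open MeasureTheory

namespace MeasureGame

/-! The unfolded measure game `G_unfolded(s, F)` for `F ⊆ 2^ω × ω^ω`: player I moves as in
the measure game; player II plays a bit at each round and, at infinitely many rounds,
additionally a natural number, thereby producing `x ∈ 2^ω` and `y ∈ ω^ω`. -/

/-- Baire space `ω^ω`. -/
abbrev Baire : Type := ℕ → ℕ

/-- A round of the unfolded game: player I's pair of rationals, then player II's bit
together with an optional digit of `y`. -/
abbrev GRoundU : Type := (ℚ × ℚ) × (Bool × Option ℕ)

/-- A strategy for player I in the unfolded game. -/
abbrev StratIU : Type := List GRoundU → ℚ × ℚ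

/-- A strategy for player II in the unfolded game. -/
abbrev StratIIU : Type := List GRoundU → ℚ × ℚ → Bool × Option ℕ

/-- A run of the unfolded game. -/
abbrev RunU : Type := ℕ → GRoundU

def histU (r : RunU) (n : ℕ) : List GRoundU := (List.range n).map r

def bitsU (r : RunU) (n : ℕ) : Bool := (r n).2.1

def pathU (r : RunU) (n : ℕ) : List Bool := (List.range n).map (bitsU r)

def valIU (r : RunU) (n : ℕ) (b : Bool) : ℚ := if b then (r n).1.2 else (r n).1.1

def selU (r : RunU) (n : ℕ) : ℚ := valIU r n (bitsU r n)

def mOKU (μ : Measure Cantor) (r : RunU) (n : ℕ) (b : Bool) : Prop :=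
  0 ≤ valIU r n b ∧ ((valIU r n b : ℝ) ≤ (μ (cyl (pathU r n ++ [b]))).toReal) ∧
    (0 < (μ (cyl (pathU r n ++ [b]))).toReal →
      (valIU r n b : ℝ) < (μ (cyl (pathU r n ++ [b]))).toReal)

def IOKU (μ : Measure Cantor) (s : ℝ) (r : RunU) : ℕ → Prop
  | 0 => mOKU μ r 0 false ∧ mOKU μ r 0 true ∧ s < ((r 0).1.1 : ℝ) + ((r 0).1.2 : ℝ)
  | (n + 1) => mOKU μ r (n + 1) false ∧ mOKU μ r (n + 1) true ∧
      (r (n + 1)).1.1 + (r (n + 1)).1.2 = selU r n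

def IIOKU (r : RunU) (n : ℕ) : Prop := selU r n ≠ 0

def ConsIU (σ : StratIU) (r : RunU) : Prop := ∀ n, (r n).1 = σ (histU r n)

def ConsIIU (τ : StratIIU) (r : RunU) : Prop := ∀ n, (r n).2 = τ (histU r n) (r n).1

/-- In the run `r`, player II plays digits at infinitely many rounds and the digits played,
in order, form exactly the sequence `y`. -/
def ProducesY (r : RunU) (y : Baire) : Prop :=
  ∃ k : ℕ → ℕ, StrictMono k ∧ (∀ n, ((r n).2.2).isSome ↔ ∃ i, k i = n) ∧
    ∀ i, (r (k i)).2.2 = some (y i)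

/-- Player II wins the run `r` of `G_unfolded(s, F)`: either player I is the first to break a
(closed) rule, or all closed rules are followed, II plays infinitely many digits producing
some `y`, and `(x, y) ∈ F`. -/
def IIWinsRunU (μ : Measure Cantor) (s : ℝ) (F : Set (Cantor × Baire)) (r : RunU) : Prop :=
  (∃ n, (∀ m < n, IOKU μ s r m ∧ IIOKU r m) ∧ ¬ IOKU μ s r n) ∨
    ((∀ n, IOKU μ s r n ∧ IIOKU r n) ∧ ∃ y : Baire, ProducesY r y ∧ (bitsU r, y) ∈ F)

/-- Player I has a winning strategy in the unfolded game `G_unfolded(s, F)`. -/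
def WinsIU (μ : Measure Cantor) (s : ℝ) (F : Set (Cantor × Baire)) : Prop :=
  ∃ σ : StratIU, ∀ r : RunU, ConsIU σ r → ¬ IIWinsRunU μ s F r

/-- Player II has a winning strategy in the unfolded game `G_unfolded(s, F)`. -/
def WinsIIU (μ : Measure Cantor) (s : ℝ) (F : Set (Cantor × Baire)) : Prop :=
  ∃ τ : StratIIU, ∀ r : RunU, ConsIIU τ r → IIWinsRunU μ s F r

/-! ## Generalities -/

/-- Prefix of a sequence. -/
def pref {β : Type*} (s : ℕ → β) (n : ℕ) : List β := (List.range n).map s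

theorem pref_succ {β : Type*} (s : ℕ → β) (n : ℕ) : pref s (n + 1) = pref s n ++ [s n] := by
  simp [pref, List.range_succ]

theorem pref_length {β : Type*} (s : ℕ → β) (n : ℕ) : (pref s n).length = n := by
  simp [pref]

theorem pref_eq_iff {β : Type*} (s s' : ℕ → β) (n : ℕ) :
    pref s n = pref s' n ↔ ∀ i < n, s i = s' i := by
  simp [pref]

theorem pref_map {β γ : Type*} (f : β → γ) (s : ℕ → β) (n : ℕ) :
    (pref s n).map f = pref (fun i => f (s i)) n := by
  simp [pref]

theorem mem_cyl_iff (x : Cantor) (t : List Bool) : x ∈ cyl t ↔ pref x t.length = t := by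
  constructor
  · intro h
    apply List.ext_getElem
    · simp [pref]
    · intro i h1 h2
      have := h ⟨i, h2⟩
      simpa [pref] using this
  · intro h i
    have : (pref x t.length)[i.1]'(by simp [pref]) = t[i.1] := by
      congr 1
    simpa [pref] using this

theorem mem_cyl_pref (x y : Cantor) (n : ℕ) : x ∈ cyl (pref y n) ↔ ∀ i < n, x i = y i := by
  rw [mem_cyl_iff, pref_length, pref_eq_iff]

theorem mem_cyl_snoc (x : Cantor) (t : List Bool) (b : Bool) :
    x ∈ cyl (t ++ [b]) ↔ x ∈ cyl t ∧ x t.length = b := by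
  rw [mem_cyl_iff, mem_cyl_iff]
  simp only [List.length_append, List.length_singleton, pref_succ]
  constructor
  · intro h
    have := List.append_inj h (by simp [pref])
    simpa using this
  · rintro ⟨h1, h2⟩
    rw [h1, h2]

theorem isOpen_of_dep (S : Set Cantor) (N : ℕ)
    (h : ∀ x x' : Cantor, (∀ i < N, x i = x' i) → x ∈ S → x' ∈ S) : IsOpen S := by
  rw [isOpen_iff_mem_nhds]
  intro x hx
  have h1 : {x' : Cantor | ∀ i ∈ Set.Iio N, x' i ∈ ({x i} : Set Bool)} ∈ nhds x := by
    have : IsOpen (Set.pi (Set.Iio N) (fun i => ({x i} : Set Bool))) :=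
      isOpen_set_pi (Set.finite_Iio N) (fun _ _ => isOpen_discrete _)
    exact this.mem_nhds (by simp [Set.mem_pi])
  refine Filter.mem_of_superset h1 ?_
  intro x' hx'
  exact h x x' (fun i hi => (hx' i hi).symm) hx

theorem isClosed_of_dep (S : Set Cantor) (N : ℕ)
    (h : ∀ x x' : Cantor, (∀ i < N, x i = x' i) → x ∈ S → x' ∈ S) : IsClosed S := by
  rw [← isOpen_compl_iff]
  refine isOpen_of_dep _ N ?_
  intro x x' hxx hx hx'
  exact hx (h x' x (fun i hi => (hxx i hi).symm) hx')

theorem isClosed_cyl (t : List Bool) : IsClosed (cyl t) := by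
  refine isClosed_of_dep _ t.length ?_
  intro x x' h hx
  rw [mem_cyl_iff] at *
  rw [← hx, pref_length, pref_eq_iff]
  exact fun i hi => (h i hi).symm

theorem measurableSet_cyl (t : List Bool) : MeasurableSet (cyl t) := (isClosed_cyl t).measurableSet

theorem cyl_nil : cyl [] = Set.univ := by
  ext x; simp [mem_cyl_iff, pref]

theorem inter_cyl_split (μ : Measure Cantor) [IsProbabilityMeasure μ] (S : Set Cantor)
    (hS : MeasurableSet S) (t : List Bool) :
    μ.real (S ∩ cyl t) = μ.real (S ∩ cyl (t ++ [false])) + μ.real (S ∩ cyl (t ++ [true])) := by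
  rw [← measureReal_union]
  · congr 1
    ext x
    simp only [Set.mem_inter_iff, Set.mem_union, mem_cyl_snoc]
    cases x t.length <;> simp
  · rw [Set.disjoint_left]
    intro x h1 h2
    simp only [Set.mem_inter_iff, mem_cyl_snoc] at h1 h2
    simp_all
  · exact hS.inter (measurableSet_cyl _)

theorem cyl_split (μ : Measure Cantor) [IsProbabilityMeasure μ] (t : List Bool) :
    μ.real (cyl t) = μ.real (cyl (t ++ [false])) + μ.real (cyl (t ++ [true])) := by
  simpa using inter_cyl_split μ Set.univ MeasurableSet.univ t

theorem closed_of_prefs (K : Set Cantor) (hK : IsClosed K) (x : Cantor)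
    (h : ∀ n, ∃ y ∈ K, ∀ i < n, x i = y i) : x ∈ K := by
  choose y hy hxy using h
  refine hK.mem_of_tendsto (b := Filter.atTop) (f := y) ?_ (Filter.Eventually.of_forall hy)
  rw [tendsto_pi_nhds]
  intro i
  refine tendsto_const_nhds.congr' ?_
  filter_upwards [Filter.eventually_gt_atTop i] with n hn
  exact hxy n i hn

/-- Density-type lemma. -/
theorem null_of_thin (μ : Measure Cantor) [IsProbabilityMeasure μ] (D : Set Cantor)
    (hD : MeasurableSet D) (c : ℝ) (hc : 0 < c) (N : ℕ)
    (h : ∀ n ≥ N, ∀ x ∈ D, c * μ.real (cyl (pref x n)) ≤ μ.real (cyl (pref x n) \ D)) :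
    μ D = 0 := by
  by_contra hne
  obtain ⟨K, hKD, hKc, hKpos⟩ := hD.exists_lt_isCompact (pos_iff_ne_zero.mpr hne)
  have hKcl := hKc.isClosed
  let T : ℕ → Set (List Bool) := fun n => (fun y => pref y n) '' K
  have hT : ∀ n, (T n).Finite := fun n => by
    refine (List.finite_length_eq Bool n).subset ?_
    rintro _ ⟨y, _, rfl⟩
    exact pref_length y n
  let Kn : ℕ → Set Cantor := fun n => ⋃ t ∈ T n, cyl t
  have memKn : ∀ n x, x ∈ Kn n ↔ ∃ y ∈ K, ∀ i < n, x i = y i := by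
    intro n x
    simp [Kn, T, mem_cyl_pref]
  have hInt : ⋂ n, Kn n = K := by
    ext x
    simp only [Set.mem_iInter, memKn]
    exact ⟨fun hx => closed_of_prefs K hKcl x hx, fun hx n => ⟨x, hx, fun _ _ => rfl⟩⟩
  have hmeas : ∀ n, MeasurableSet (Kn n) := fun n =>
    Set.Finite.measurableSet_biUnion (hT n) (fun t _ => measurableSet_cyl t)
  have hsub : ∀ n, K ⊆ Kn n := fun n x hx => (memKn n x).2 ⟨x, hx, fun _ _ => rfl⟩
  have hanti : Antitone Kn := by
    intro m n hmn x hx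
    rw [memKn] at *
    obtain ⟨y, hy, h⟩ := hx
    exact ⟨y, hy, fun i hi => h i (lt_of_lt_of_le hi hmn)⟩
  have hlim : Filter.Tendsto (fun n => μ.real (Kn n)) Filter.atTop (nhds (μ.real K)) := by
    have := tendsto_measure_iInter_atTop (μ := μ) (s := Kn)
      (fun n => (hmeas n).nullMeasurableSet) hanti ⟨0, measure_ne_top _ _⟩
    rw [hInt] at this
    exact (ENNReal.tendsto_toReal (measure_ne_top _ _)).comp this
  have hdisj : ∀ n, (T n).PairwiseDisjoint cyl := by
    intro n
    rintro _ ⟨y, _, rfl⟩ _ ⟨z, _, rfl⟩ hne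
    rw [Function.onFun, Set.disjoint_left]
    intro x hx hx'
    rw [mem_cyl_iff, pref_length] at hx hx'
    exact hne (hx.symm.trans hx')
  have hle : ∀ n ≥ N, c * μ.real (Kn n) ≤ μ.real (Kn n) - μ.real K := by
    intro n hn
    rw [← measureReal_sdiff (hsub n) hKcl.measurableSet (measure_ne_top _ _)]
    have e1 : Kn n = ⋃ t ∈ (hT n).toFinset, cyl t := by simp [Kn]
    have e2 : Kn n \ K = ⋃ t ∈ (hT n).toFinset, (cyl t \ K) := by
      rw [e1]; ext x; simp; grind
    rw [e2, e1, measureReal_biUnion_finset, measureReal_biUnion_finset, Finset.mul_sum]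
    · refine Finset.sum_le_sum ?_
      intro t ht
      have ht' : t ∈ T n := by simpa using ht
      obtain ⟨y, hy, rfl⟩ := ht'
      refine (h n hn y (hKD hy)).trans ?_
      exact measureReal_mono (Set.sdiff_subset_sdiff_right hKD)
    · intro a ha b hb hab
      have := hdisj n (by simpa using ha) (by simpa using hb) hab
      exact this.mono Set.sdiff_subset Set.sdiff_subset
    · exact fun t _ => (measurableSet_cyl t).diff hKcl.measurableSet
    · simpa using hdisj n
    · exact fun t _ => measurableSet_cyl t
  have hfin : c * μ.real K ≤ μ.real K - μ.real K := by
    refine le_of_tendsto_of_tendsto (hlim.const_mul c) (hlim.sub_const _) ?_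
    filter_upwards [Filter.eventually_ge_atTop N] with n hn using hle n hn
  have hpos : 0 < μ.real K := ENNReal.toReal_pos hKpos.ne' (measure_ne_top _ _)
  nlinarith [mul_pos hc hpos]

/-! ## Weights on the tree of moves of player II -/

abbrev Mv : Type := Bool × Option ℕ

/-- cylinder of a position -/
def nb (p : List Mv) : Set Cantor := cyl (p.map Prod.fst)

structure IsWeight (μ : Measure Cantor) (W : List Mv → ℝ) : Prop where
  nonneg : ∀ p, 0 ≤ W p
  le : ∀ p, W p ≤ μ.real (nb p)
  add : ∀ p d d', W p = W (p ++ [(false, d)]) + W (p ++ [(true, d')])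

theorem IsWeight.indep {μ : Measure Cantor} {W : List Mv → ℝ} (hW : IsWeight μ W)
    (p : List Mv) (b : Bool) (d d' : Option ℕ) : W (p ++ [(b, d)]) = W (p ++ [(b, d')]) := by
  cases b
  · linarith [hW.add p d none, hW.add p d' none]
  · linarith [hW.add p none d, hW.add p none d']

theorem IsWeight.mono {μ : Measure Cantor} {W : List Mv → ℝ} (hW : IsWeight μ W)
    (p q : List Mv) : W (p ++ q) ≤ W p := by
  induction q using List.reverseRecOn with
  | nil => simp
  | append_singleton q a ih =>
    refine le_trans ?_ ih
    rw [← List.append_assoc]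
    obtain ⟨b, d⟩ := a
    have h := hW.add (p ++ q) d d
    have h1 := hW.nonneg (p ++ q ++ [(false, d)])
    have h2 := hW.nonneg (p ++ q ++ [(true, d)])
    cases b <;> linarith

/-- digit-free extension of a position along `x` -/
def ext (p : List Mv) (x : Cantor) : ℕ → List Mv
  | 0 => p
  | j + 1 => ext p x j ++ [(x (ext p x j).length, none)]

theorem ext_front (p : List Mv) (x : Cantor) (j : ℕ) :
    ext p x (j + 1) = ext (p ++ [(x p.length, none)]) x j := by
  induction j with
  | zero => rfl
  | succ j ih => rw [ext, ih]; rfl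

theorem ext_length (p : List Mv) (x : Cantor) (j : ℕ) : (ext p x j).length = p.length + j := by
  induction j with
  | zero => rfl
  | succ j ih => simp [ext, ih]; omega

theorem ext_congr (p : List Mv) (x x' : Cantor) (j : ℕ) (h : ∀ i < p.length + j, x i = x' i) :
    ext p x j = ext p x' j := by
  induction j with
  | zero => rfl
  | succ j ih =>
    have := ih (fun i hi => h i (by omega))
    rw [ext, ext, this, h _ (by rw [ext_length]; omega)]

theorem mem_nb_snoc (x : Cantor) (p : List Mv) (a : Mv) :
    x ∈ nb (p ++ [a]) ↔ x ∈ nb p ∧ x p.length = a.1 := by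
  simp [nb, mem_cyl_snoc]

theorem mem_nb_ext (x : Cantor) (p : List Mv) (j : ℕ) (hx : x ∈ nb p) : x ∈ nb (ext p x j) := by
  induction j with
  | zero => exact hx
  | succ j ih => rw [ext, mem_nb_snoc]; exact ⟨ih, rfl⟩

theorem measurableSet_nb (p : List Mv) : MeasurableSet (nb p) := measurableSet_cyl _

theorem nb_eq_of_mem (x : Cantor) (p : List Mv) (hx : x ∈ nb p) : nb p = cyl (pref x p.length) := by
  rw [nb, mem_cyl_iff] at hx
  rw [nb, ← hx]; simp

theorem nb_split (μ : Measure Cantor) [IsProbabilityMeasure μ] (p : List Mv) (d d' : Option ℕ) :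
    μ.real (nb p) = μ.real (nb (p ++ [(false, d)])) + μ.real (nb (p ++ [(true, d')])) := by
  simp only [nb, List.map_append, List.map_cons, List.map_nil]
  exact cyl_split μ _

/-- points satisfying the density condition up to level `j` -/
def Kj (μ : Measure Cantor) (W : List Mv → ℝ) (c : ℝ) (p : List Mv) (j : ℕ) : Set Cantor :=
  {x | x ∈ nb p ∧ ∀ i ≤ j, c * μ.real (nb (ext p x i)) ≤ W (ext p x i)}

def Kc (μ : Measure Cantor) (W : List Mv → ℝ) (c : ℝ) (p : List Mv) : Set Cantor :=
  ⋂ j, Kj μ W c p j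

def Gd (μ : Measure Cantor) (W : List Mv → ℝ) (p : List Mv) : Set Cantor :=
  ⋃ m : ℕ, Kc μ W (1 / ((m : ℝ) + 1)) p

theorem measurableSet_Kj (μ : Measure Cantor) (W : List Mv → ℝ) (c : ℝ) (p : List Mv) (j : ℕ) :
    MeasurableSet (Kj μ W c p j) := by
  refine (isClosed_of_dep _ (p.length + j) ?_).measurableSet
  rintro x x' h ⟨h1, h2⟩
  refine ⟨?_, ?_⟩
  · rw [nb, mem_cyl_iff] at *
    rw [← h1, pref_length, pref_eq_iff]
    intro i hi
    refine (h i ?_).symm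
    simp at hi
    omega
  · intro i hi
    rw [← ext_congr p x x' i (fun k hk => h k (by omega))]
    exact h2 i hi

theorem measurableSet_Kc (μ : Measure Cantor) (W : List Mv → ℝ) (c : ℝ) (p : List Mv) :
    MeasurableSet (Kc μ W c p) := MeasurableSet.iInter (fun j => measurableSet_Kj μ W c p j)

theorem measurableSet_Gd (μ : Measure Cantor) (W : List Mv → ℝ) (p : List Mv) :
    MeasurableSet (Gd μ W p) := MeasurableSet.iUnion (fun _ => measurableSet_Kc μ W _ p)

theorem Gd_subset (μ : Measure Cantor) (W : List Mv → ℝ) (p : List Mv) : Gd μ W p ⊆ nb p := by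
  intro x hx
  obtain ⟨m, hm⟩ := Set.mem_iUnion.1 hx
  exact (Set.mem_iInter.1 hm 0).1

theorem Kj_bound (μ : Measure Cantor) [IsProbabilityMeasure μ] (W : List Mv → ℝ)
    (hW : IsWeight μ W) (c : ℝ) (hc : 0 ≤ c) (j : ℕ) (p : List Mv) :
    W p - c * μ.real (nb p) ≤ μ.real (Kj μ W c p j) := by
  induction j generalizing p with
  | zero =>
    by_cases h : c * μ.real (nb p) ≤ W p
    · have : Kj μ W c p 0 = nb p := by
        ext x; simp [Kj, ext, h]
      rw [this]
      have h0 : 0 ≤ c * μ.real (nb p) := mul_nonneg hc measureReal_nonneg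
      linarith [hW.le p]
    · push Not at h
      linarith [measureReal_nonneg (μ := μ) (s := Kj μ W c p 0)]
  | succ j ih =>
    by_cases h : c * μ.real (nb p) ≤ W p
    · have e : Kj μ W c p (j + 1) =
          Kj μ W c (p ++ [(false, none)]) j ∪ Kj μ W c (p ++ [(true, none)]) j := by
        ext x
        simp only [Kj, Set.mem_union, Set.mem_ofPred_eq, mem_nb_snoc]
        have key : (∀ i ≤ j + 1, c * μ.real (nb (ext p x i)) ≤ W (ext p x i)) ↔
            ∀ i ≤ j, c * μ.real (nb (ext (p ++ [(x p.length, none)]) x i)) ≤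
              W (ext (p ++ [(x p.length, none)]) x i) := by
          constructor
          · intro h' i hi
            rw [← ext_front]; exact h' (i + 1) (by omega)
          · intro h' i hi
            cases i with
            | zero => exact h
            | succ i => rw [ext_front]; exact h' i (by omega)
        rw [key]
        cases x p.length <;> simp
      rw [e, measureReal_union]
      · have := ih (p ++ [(false, none)])
        have := ih (p ++ [(true, none)])
        rw [hW.add p none none, nb_split μ p none none]
        linarith
      · rw [Set.disjoint_left]
        intro x h1 h2
        have h1 := h1.1
        have h2 := h2.1
        simp only [mem_nb_snoc] at h1 h2
        simp_all
      · exact measurableSet_Kj _ _ _ _ _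
    · push Not at h
      linarith [measureReal_nonneg (μ := μ) (s := Kj μ W c p (j + 1))]

theorem Kc_bound (μ : Measure Cantor) [IsProbabilityMeasure μ] (W : List Mv → ℝ)
    (hW : IsWeight μ W) (c : ℝ) (hc : 0 ≤ c) (p : List Mv) :
    W p - c * μ.real (nb p) ≤ μ.real (Kc μ W c p) := by
  have hanti : Antitone (Kj μ W c p) := by
    rintro m n hmn x ⟨h1, h2⟩
    exact ⟨h1, fun i hi => h2 i (hi.trans hmn)⟩
  have hlim : Filter.Tendsto (fun n => μ.real (Kj μ W c p n)) Filter.atTop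
      (nhds (μ.real (Kc μ W c p))) := by
    have := tendsto_measure_iInter_atTop (μ := μ) (s := Kj μ W c p)
      (fun n => (measurableSet_Kj μ W c p n).nullMeasurableSet) hanti ⟨0, measure_ne_top _ _⟩
    exact (ENNReal.tendsto_toReal (measure_ne_top _ _)).comp this
  exact ge_of_tendsto' hlim (fun j => Kj_bound μ W hW c hc j p)

theorem Gd_bound (μ : Measure Cantor) [IsProbabilityMeasure μ] (W : List Mv → ℝ)
    (hW : IsWeight μ W) (p : List Mv) : W p ≤ μ.real (Gd μ W p) := by
  have h : ∀ m : ℕ, W p - 1 / ((m : ℝ) + 1) * μ.real (nb p) ≤ μ.real (Gd μ W p) := fun m =>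
    (Kc_bound μ W hW _ (by positivity) p).trans
      (measureReal_mono (Set.subset_iUnion (fun m : ℕ => Kc μ W (1 / ((m : ℝ) + 1)) p) m))
  have hlim : Filter.Tendsto (fun m : ℕ => W p - 1 / ((m : ℝ) + 1) * μ.real (nb p)) Filter.atTop
      (nhds (W p - 0 * μ.real (nb p))) :=
    (tendsto_one_div_add_atTop_nhds_zero_nat.mul_const _).const_sub _
  rw [zero_mul, sub_zero] at hlim
  exact le_of_tendsto' hlim h

/-- position after playing the digit `k` at stage `j`. -/
def stp (p : List Mv) (x : Cantor) (k j : ℕ) : List Mv :=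
  ext p x j ++ [(x (ext p x j).length, some k)]

def Bad (μ : Measure Cantor) (W : List Mv → ℝ) (c : ℝ) (p : List Mv) (k : ℕ) : Set Cantor :=
  Kc μ W c p \ ⋃ j, {x | x ∈ Gd μ W (stp p x k j)}

theorem measurableSet_Bad (μ : Measure Cantor) (W : List Mv → ℝ) (c : ℝ) (p : List Mv) (k : ℕ) :
    MeasurableSet (Bad μ W c p k) := by
  refine (measurableSet_Kc μ W c p).diff (MeasurableSet.iUnion fun j => ?_)
  have : {x | x ∈ Gd μ W (stp p x k j)} = ⋃ q : List Mv, {x | stp p x k j = q} ∩ Gd μ W q := by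
    ext x; simp
  rw [this]
  refine MeasurableSet.iUnion fun q => MeasurableSet.inter ?_ (measurableSet_Gd μ W q)
  refine (isClosed_of_dep _ (p.length + j + 1) ?_).measurableSet
  intro x x' h hx
  have e := ext_congr p x x' j (fun i hi => h i (by omega))
  simp only [Set.mem_ofPred_eq, stp] at *
  rw [← hx, ← e, h _ (by rw [ext_length]; omega)]

theorem Bad_null (μ : Measure Cantor) [IsProbabilityMeasure μ] (W : List Mv → ℝ)
    (hW : IsWeight μ W) (c : ℝ) (hc : 0 < c) (p : List Mv) (k : ℕ) : μ (Bad μ W c p k) = 0 := by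
  refine null_of_thin μ _ (measurableSet_Bad μ W c p k) c hc (p.length + 1) ?_
  intro n hn x hx
  obtain ⟨j, rfl⟩ : ∃ j, n = p.length + (j + 1) := ⟨n - p.length - 1, by omega⟩
  have hxp : x ∈ nb p := (Set.mem_iInter.1 hx.1 0).1
  have h1 : c * μ.real (nb (ext p x (j + 1))) ≤ W (ext p x (j + 1)) :=
    (Set.mem_iInter.1 hx.1 (j + 1)).2 (j + 1) le_rfl
  have e : nb (ext p x (j + 1)) = cyl (pref x (p.length + (j + 1))) := by
    rw [nb_eq_of_mem x _ (mem_nb_ext x p (j + 1) hxp), ext_length]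
  have e' : nb (stp p x k j) = nb (ext p x (j + 1)) := by
    simp [nb, stp, ext]
  rw [e] at h1
  refine h1.trans ?_
  have h2 : W (ext p x (j + 1)) = W (stp p x k j) := hW.indep _ _ _ _
  rw [h2]
  refine (Gd_bound μ W hW _).trans (measureReal_mono ?_)
  intro x' hx'
  have h3 : x' ∈ cyl (pref x (p.length + (j + 1))) := by
    rw [← e, ← e']; exact Gd_subset _ _ _ hx'
  refine ⟨h3, fun hb => hb.2 (Set.mem_iUnion.2 ⟨j, ?_⟩)⟩
  rw [mem_cyl_pref] at h3
  have e4 := ext_congr p x' x j (fun i hi => h3 i (by omega))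
  have : stp p x' k j = stp p x k j := by
    rw [stp, stp, e4, h3 _ (by rw [ext_length]; omega)]
  simp only [Set.mem_ofPred_eq, this]
  exact hx'

theorem exists_good_point (μ : Measure Cantor) [IsProbabilityMeasure μ] (W : List Mv → ℝ)
    (hW : IsWeight μ W) (h0 : 0 < W []) :
    ∃ x : Cantor, x ∈ Gd μ W [] ∧
      (∀ p k, x ∈ Gd μ W p → ∃ j, x ∈ Gd μ W (stp p x k j)) ∧
      ∀ n, 0 < μ.real (cyl (pref x n)) := by
  have h1 : ∀ᵐ x ∂μ, ∀ p : List Mv, ∀ k m : ℕ, x ∉ Bad μ W (1 / ((m : ℝ) + 1)) p k := by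
    simp only [ae_all_iff]
    intro p k m
    exact measure_eq_zero_iff_ae_notMem.1 (Bad_null μ W hW _ (by positivity) p k)
  have h2 : ∀ᵐ x ∂μ, ∀ t : List Bool, μ (cyl t) = 0 → x ∉ cyl t := by
    rw [ae_all_iff]
    intro t
    by_cases ht : μ (cyl t) = 0
    · filter_upwards [measure_eq_zero_iff_ae_notMem.1 ht] with x hx _ using hx
    · exact Filter.Eventually.of_forall fun x h => absurd h ht
  have h3 : ∃ x ∈ Gd μ W [], (∀ p : List Mv, ∀ k m : ℕ, x ∉ Bad μ W (1 / ((m : ℝ) + 1)) p k) ∧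
      ∀ t : List Bool, μ (cyl t) = 0 → x ∉ cyl t := by
    by_contra hcon
    push Not at hcon
    have h4 : ∀ᵐ x ∂μ, x ∉ Gd μ W [] := by
      filter_upwards [h1, h2] with x hx1 hx2 hx
      obtain ⟨t, ht1, ht2⟩ := hcon x hx hx1
      exact hx2 t ht1 ht2
    have h5 := measure_eq_zero_iff_ae_notMem.2 h4
    have h6 := Gd_bound μ W hW []
    rw [Measure.real, h5] at h6
    simp at h6
    linarith
  obtain ⟨x, hx, hx1, hx2⟩ := h3
  refine ⟨x, hx, ?_, ?_⟩
  · intro p k hp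
    obtain ⟨m, hm⟩ := Set.mem_iUnion.1 hp
    by_contra hcon
    refine hx1 p k m ⟨hm, ?_⟩
    simpa using hcon
  · intro n
    refine ENNReal.toReal_pos (fun h => hx2 _ h ?_) (measure_ne_top _ _)
    rw [mem_cyl_pref]
    exact fun _ _ => rfl

theorem ext_none (s : ℕ → Mv) (x : Cantor) (p : List Mv) (j : ℕ)
    (h : ext p x j = pref s (p.length + j)) :
    pref s p.length = p ∧ ∀ m, p.length ≤ m → m < p.length + j → (s m).2 = none := by
  induction j with
  | zero => exact ⟨h.symm, fun m h1 h2 => by omega⟩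
  | succ j ih =>
    rw [ext, ← add_assoc, pref_succ] at h
    obtain ⟨h1, h2⟩ := List.append_inj h (by rw [ext_length, pref_length])
    obtain ⟨h3, h4⟩ := ih h1
    refine ⟨h3, fun m hm1 hm2 => ?_⟩
    by_cases hm : m < p.length + j
    · exact h4 m hm1 hm
    · have : m = p.length + j := by omega
      subst this
      simp only [List.cons.injEq, and_true] at h2
      rw [← h2]

theorem weight_chain (μ : Measure Cantor) [IsProbabilityMeasure μ] (W : List Mv → ℝ)
    (hW : IsWeight μ W) (h0 : 0 < W []) :
    ∃ x : Cantor, ∀ y : Baire, ∃ s : ℕ → Mv, (∀ n, (s n).1 = x n) ∧ (∀ n, 0 < W (pref s n)) ∧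
      ∃ k : ℕ → ℕ, StrictMono k ∧ (∀ n, ((s n).2).isSome ↔ ∃ i, k i = n) ∧
        ∀ i, (s (k i)).2 = some (y i) := by
  obtain ⟨x, hx0, hx1, hx2⟩ := exists_good_point μ W hW h0
  refine ⟨x, fun y => ?_⟩
  choose J hJ using hx1
  let P : ℕ → {p : List Mv // x ∈ Gd μ W p} := fun i =>
    Nat.rec ⟨[], hx0⟩ (fun i q => ⟨stp q.1 x (y i) (J q.1 (y i) q.2), hJ q.1 (y i) q.2⟩) i
  let j : ℕ → ℕ := fun i => J (P i).1 (y i) (P i).2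
  have P0 : (P 0).1 = [] := rfl
  have PS : ∀ i, (P (i + 1)).1 = ext (P i).1 x (j i) ++
      [(x (ext (P i).1 x (j i)).length, some (y i))] := fun i => rfl
  let L : ℕ → ℕ := fun i => (P i).1.length
  have L0 : L 0 = 0 := rfl
  have LS : ∀ i, L (i + 1) = L i + j i + 1 := fun i => by
    simp only [L, PS, List.length_append, ext_length, List.length_singleton]
  have Lmono : StrictMono L := strictMono_nat_of_lt_succ fun i => by rw [LS]; omega
  have ext_pre : ∀ (p : List Mv) (m : ℕ), p <+: ext p x m := by
    intro p m
    induction m with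
    | zero => exact List.prefix_rfl
    | succ m ih => exact ih.trans (List.prefix_append _ _)
  have pre1 : ∀ i, (P i).1 <+: (P (i + 1)).1 := fun i => by
    rw [PS]; exact (ext_pre _ _).trans (List.prefix_append _ _)
  have pre : ∀ i i', i ≤ i' → (P i).1 <+: (P i').1 := by
    intro i i' h
    induction i', h using Nat.le_induction with
    | base => exact List.prefix_rfl
    | succ i' _ ih => exact ih.trans (pre1 i')
  let s : ℕ → Mv := fun n => ((P (n + 1)).1[n]?).getD (false, none)
  have hs : ∀ i, pref s (L i) = (P i).1 := by
    intro i
    apply List.ext_getElem (by rw [pref_length])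
    intro n h1 h2
    simp only [pref, List.getElem_map, List.getElem_range, s]
    have hn : n < (P (n + 1)).1.length := lt_of_lt_of_le (Nat.lt_succ_self n) (Lmono.le_apply)
    rw [List.getElem?_eq_getElem hn, Option.getD_some]
    rcases le_total i (n + 1) with h | h
    · exact ((pre _ _ h).getElem h2).symm
    · exact (pre _ _ h).getElem hn
  have hWpos : ∀ i, 0 < W (P i).1 := by
    intro i
    obtain ⟨m, hm⟩ := Set.mem_iUnion.1 (P i).2
    have h1 := (Set.mem_iInter.1 hm 0)
    have h2 : 1 / ((m : ℝ) + 1) * μ.real (nb (P i).1) ≤ W (P i).1 := h1.2 0 le_rfl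
    rw [nb_eq_of_mem x _ h1.1] at h2
    refine lt_of_lt_of_le (mul_pos (by positivity) (hx2 _)) h2
  have hkey : ∀ i, pref s (L i + j i) = ext (P i).1 x (j i) ∧
      s (L i + j i) = (x (ext (P i).1 x (j i)).length, some (y i)) := by
    intro i
    have h := hs (i + 1)
    rw [LS, pref_succ, PS] at h
    obtain ⟨h1, h2⟩ := List.append_inj h (by rw [ext_length, pref_length])
    exact ⟨h1, by simpa using h2⟩
  refine ⟨s, ?_, ?_, fun i => L i + j i, ?_, ?_, ?_⟩
  · intro n
    have h1 : x ∈ nb (pref s (L (n + 1))) := by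
      rw [hs (n + 1)]; exact Gd_subset _ _ _ (P (n + 1)).2
    rw [nb, mem_cyl_iff, pref_map, pref_length, pref_eq_iff] at h1
    exact (h1 n (lt_of_lt_of_le (Nat.lt_succ_self n) (Lmono.le_apply))).symm
  · intro n
    have h1 : pref s n <+: pref s (L n) := by
      have : n ≤ L n := Lmono.le_apply
      obtain ⟨e, he⟩ := Nat.exists_eq_add_of_le this
      rw [he]
      clear he this
      induction e with
      | zero => exact List.prefix_rfl
      | succ e ih => rw [← add_assoc, pref_succ]; exact ih.trans (List.prefix_append _ _)
    obtain ⟨q, hq⟩ := h1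
    have := hWpos n
    rw [← hs, ← hq] at this
    exact this.trans_le (hW.mono _ _)
  · refine strictMono_nat_of_lt_succ fun i => ?_
    have := LS i
    omega
  · intro n
    constructor
    · intro hsome
      have hex : ∃ i, n < L (i + 1) := ⟨n, lt_of_lt_of_le (Nat.lt_succ_self n) (Lmono.le_apply)⟩
      classical
      let i := Nat.find hex
      have hi : n < L (i + 1) := Nat.find_spec hex
      have hi' : L i ≤ n := by
        by_contra hcon
        push Not at hcon
        rcases Nat.eq_zero_or_pos i with h | h
        · rw [h, L0] at hcon; omega
        · have := Nat.find_min hex (m := i - 1) (by omega)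
          rw [Nat.sub_add_cancel h] at this
          exact this hcon
      refine ⟨i, ?_⟩
      by_contra hne
      have := (ext_none s x (P i).1 (j i) (hkey i).1.symm).2 n hi' (by
        have := LS i
        change n < L i + j i
        change ¬ (L i + j i = n) at hne
        omega)
      rw [this] at hsome
      simp at hsome
    · rintro ⟨i, rfl⟩
      simp [(hkey i).2]
  · intro i
    simp [(hkey i).2]

/-! ## Runs -/

def mkH {ρ : Type*} (Φ : List ρ → ρ) : ℕ → List ρ
  | 0 => []
  | n + 1 => mkH Φ n ++ [Φ (mkH Φ n)]

def mkRun {ρ : Type*} (Φ : List ρ → ρ) (n : ℕ) : ρ := Φ (mkH Φ n)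

theorem pref_mkRun {ρ : Type*} (Φ : List ρ → ρ) (n : ℕ) : pref (mkRun Φ) n = mkH Φ n := by
  induction n with
  | zero => rfl
  | succ n ih => rw [pref_succ, ih]; rfl

theorem mkRun_eq {ρ : Type*} (Φ : List ρ → ρ) (n : ℕ) : mkRun Φ n = Φ (pref (mkRun Φ) n) := by
  rw [pref_mkRun]; rfl

def vl (m : ℚ × ℚ) (b : Bool) : ℚ := if b then m.2 else m.1

/-- State after player II's moves `p` against `σ`: history and current weight. -/
def stt (σ : StratIU) (p : List Mv) : List GRoundU × ℚ :=
  p.foldl (fun h a => (h.1 ++ [(σ h.1, a)], if h.2 = 0 then 0 else vl (σ h.1) a.1))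
    ([], (σ []).1 + (σ []).2)

def wt (σ : StratIU) (p : List Mv) : ℚ := (stt σ p).2

theorem stt_snoc (σ : StratIU) (p : List Mv) (a : Mv) :
    stt σ (p ++ [a]) = ((stt σ p).1 ++ [(σ (stt σ p).1, a)],
      if wt σ p = 0 then 0 else vl (σ (stt σ p).1) a.1) := by
  rw [stt, List.foldl_append]; rfl

/-- the run where I follows `σ` and II plays `s` -/
def runI (σ : StratIU) (s : ℕ → Mv) : RunU := mkRun fun h => (σ h, s h.length)

theorem runI_eq (σ : StratIU) (s : ℕ → Mv) (n : ℕ) :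
    runI σ s n = (σ (histU (runI σ s) n), s n) := by
  have := mkRun_eq (fun h => ((σ h, s h.length) : GRoundU)) n
  rw [pref_length] at this
  exact this

theorem stt_pref (σ : StratIU) (s : ℕ → Mv) (n : ℕ) :
    (stt σ (pref s n)).1 = histU (runI σ s) n := by
  induction n with
  | zero => rfl
  | succ n ih =>
    rw [pref_succ, stt_snoc, ih]
    have : histU (runI σ s) (n + 1) = histU (runI σ s) n ++ [runI σ s n] := pref_succ _ _
    rw [this, runI_eq]

theorem wt_pref (σ : StratIU) (s : ℕ → Mv) (n : ℕ) :
    wt σ (pref s (n + 1)) = if wt σ (pref s n) = 0 then 0 else selU (runI σ s) n := by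
  rw [wt, pref_succ, stt_snoc, stt_pref]
  simp only [selU, valIU, bitsU, runI_eq, vl]

theorem wt_ne (σ : StratIU) (s : ℕ → Mv) (n : ℕ) (h : wt σ (pref s n) ≠ 0) :
    ∀ m < n, wt σ (pref s m) ≠ 0 ∧ IIOKU (runI σ s) m := by
  induction n with
  | zero => intro m hm; omega
  | succ n ih =>
    rw [wt_pref] at h
    have h1 : wt σ (pref s n) ≠ 0 := fun h' => h (by simp [h'])
    rw [if_neg h1] at h
    intro m hm
    rcases Nat.lt_succ_iff_lt_or_eq.1 hm with hm | rfl
    · exact ih h1 m hm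
    · exact ⟨h1, h⟩

theorem consI_runI (σ : StratIU) (s : ℕ → Mv) : ConsIU σ (runI σ s) := fun n => by
  rw [runI_eq]

theorem legalI (μ : Measure Cantor) (R : Set (Cantor × Baire)) (σ : StratIU)
    (hσ : ∀ r : RunU, ConsIU σ r → ¬ IIWinsRunU μ 0 R r) (s : ℕ → Mv) (n : ℕ)
    (h : n = 0 ∨ wt σ (pref s n) ≠ 0) : IOKU μ 0 (runI σ s) n := by
  induction n using Nat.strong_induction_on with
  | _ n ih =>
    by_contra hcon
    refine hσ _ (consI_runI σ s) (Or.inl ⟨n, ?_, hcon⟩)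
    intro m hm
    rcases h with h | h
    · omega
    · obtain ⟨h1, h2⟩ := wt_ne σ s n h m hm
      exact ⟨ih m hm (Or.inr h1), h2⟩

theorem pathU_runI (σ : StratIU) (s : ℕ → Mv) (n : ℕ) :
    pathU (runI σ s) n = (pref s n).map Prod.fst := by
  rw [pref_map, pathU, ← pref]
  apply (pref_eq_iff _ _ _).2
  intro i _
  simp [bitsU, runI_eq]

theorem legal_facts (μ : Measure Cantor) (R : Set (Cantor × Baire)) (σ : StratIU)
    (hσ : ∀ r : RunU, ConsIU σ r → ¬ IIWinsRunU μ 0 R r) (p : List Mv)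
    (h : p = [] ∨ wt σ p ≠ 0) :
    (∀ b, 0 ≤ vl (σ (stt σ p).1) b ∧
      ((vl (σ (stt σ p).1) b : ℚ) : ℝ) ≤ μ.real (cyl (p.map Prod.fst ++ [b]))) ∧
    (σ (stt σ p).1).1 + (σ (stt σ p).1).2 = wt σ p ∧ (p = [] → 0 < wt σ p) := by
  let s : ℕ → Mv := fun n => (p[n]?).getD (false, none)
  have hp : pref s p.length = p := by
    apply List.ext_getElem (by rw [pref_length])
    intro n h1 h2
    simp [pref, s, h2]
  have hl := legalI μ R σ hσ s p.length (by
    rw [hp]; rcases h with h | h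
    · left; simp [h]
    · right; exact h)
  have e1 : (stt σ p).1 = histU (runI σ s) p.length := by rw [← stt_pref, hp]
  have e2 : (runI σ s p.length).1 = σ (stt σ p).1 := by rw [runI_eq, e1]
  have e3 : pathU (runI σ s) p.length = p.map Prod.fst := by rw [pathU_runI, hp]
  have hv : ∀ b, valIU (runI σ s) p.length b = vl (σ (stt σ p).1) b := by
    intro b; rw [valIU, e2, vl]
  have hm : mOKU μ (runI σ s) p.length false ∧ mOKU μ (runI σ s) p.length true := by
    cases hn : p.length with
    | zero => rw [hn] at hl; exact ⟨hl.1, hl.2.1⟩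
    | succ n => rw [hn] at hl; exact ⟨hl.1, hl.2.1⟩
  refine ⟨?_, ?_, ?_⟩
  · intro b
    have : mOKU μ (runI σ s) p.length b := by
      cases b
      · exact hm.1
      · exact hm.2
    rw [mOKU, hv, e3] at this
    exact ⟨this.1, this.2.1⟩
  · rcases List.eq_nil_or_concat p with rfl | ⟨q, a, hq⟩
    · rfl
    · have hne : wt σ p ≠ 0 := by
        rcases h with h | h
        · simp [h] at hq
        · exact h
      have hn : p.length = q.length + 1 := by simp [hq]
      rw [← e2]
      rw [hn] at hl ⊢
      rw [hl.2.2]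
      have := wt_pref σ s q.length
      rw [← hn, hp] at this
      rw [this, if_neg]
      intro h'
      rw [if_pos h'] at this
      exact hne this
  · rintro rfl
    have := hl.2.2
    rw [runI_eq] at this
    have h2 : wt σ [] = (σ []).1 + (σ []).2 := rfl
    rw [h2]
    have h3 : histU (runI σ s) 0 = [] := rfl
    simp only [h3] at this
    exact_mod_cast this

theorem wt_isWeight (μ : Measure Cantor) [IsProbabilityMeasure μ] (R : Set (Cantor × Baire))
    (σ : StratIU) (hσ : ∀ r : RunU, ConsIU σ r → ¬ IIWinsRunU μ 0 R r) :
    IsWeight μ (fun p => (wt σ p : ℝ)) ∧ 0 < wt σ [] := by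
  have hf := legal_facts μ R σ hσ
  have h0 := (hf [] (Or.inl rfl)).2.2 rfl
  have hs : ∀ p a, wt σ (p ++ [a]) = if wt σ p = 0 then 0 else vl (σ (stt σ p).1) a.1 := by
    intro p a; rw [wt, stt_snoc]
  have hadd : ∀ p d d', wt σ p = wt σ (p ++ [(false, d)]) + wt σ (p ++ [(true, d')]) := by
    intro p d d'
    rw [hs, hs]
    by_cases h : wt σ p = 0
    · simp [h]
    · rw [if_neg h, if_neg h, ← (hf p (Or.inr h)).2.1]
      simp [vl]
  have hb : ∀ p a, 0 ≤ wt σ (p ++ [a]) ∧ (wt σ (p ++ [a]) : ℝ) ≤ μ.real (nb (p ++ [a])) := by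
    intro p a
    rw [hs]
    by_cases h : wt σ p = 0
    · simp [h]
    · rw [if_neg h]
      have := (hf p (Or.inr h)).1 a.1
      simpa [nb] using this
  refine ⟨⟨?_, ?_, ?_⟩, h0⟩
  · intro p
    rcases List.eq_nil_or_concat p with rfl | ⟨q, a, hq⟩
    · exact_mod_cast h0.le
    · rw [hq, List.concat_eq_append]; exact_mod_cast (hb q a).1
  · intro p
    rcases List.eq_nil_or_concat p with rfl | ⟨q, a, hq⟩
    · have h1 := (hb [] (false, none)).2
      have h2 := (hb [] (true, none)).2
      have h3 := nb_split μ [] none none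
      have h4 := hadd [] none none
      change ((wt σ [] : ℚ) : ℝ) ≤ _
      rw [h4, h3]
      push_cast
      linarith
    · rw [hq, List.concat_eq_append]; exact (hb q a).2
  · intro p d d'
    exact_mod_cast hadd p d d'

theorem not_winsI (μ : Measure Cantor) [IsProbabilityMeasure μ] (R : Set (Cantor × Baire))
    (htotal : ∀ x : Cantor, ∃ y : Baire, (x, y) ∈ R) : ¬ WinsIU μ 0 R := by
  rintro ⟨σ, hσ⟩
  obtain ⟨hW, h0⟩ := wt_isWeight μ R σ hσ
  obtain ⟨x, hx⟩ := weight_chain μ _ hW (by exact_mod_cast h0)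
  obtain ⟨y, hy⟩ := htotal x
  obtain ⟨s, hs1, hs2, k, hk1, hk2, hk3⟩ := hx y
  have hne : ∀ n, wt σ (pref s n) ≠ 0 := fun n => by
    have := hs2 n
    exact_mod_cast this.ne'
  refine hσ _ (consI_runI σ s) (Or.inr ⟨fun n => ⟨legalI μ R σ hσ s n (Or.inr (hne n)),
    (wt_ne σ s (n + 1) (hne _) n (Nat.lt_succ_self n)).2⟩, y, ⟨k, hk1, ?_, ?_⟩, ?_⟩)
  · intro n; rw [runI_eq]; exact hk2 n
  · intro i; rw [runI_eq]; exact hk3 i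
  · have : bitsU (runI σ s) = x := by
      funext n; rw [bitsU, runI_eq]; exact hs1 n
    rw [this]; exact hy

/-! ## Measurable selection -/

theorem selection (μ : Measure Cantor) [IsProbabilityMeasure μ] (Z : Set (ℕ → ℕ))
    (g : (ℕ → ℕ) → Cantor)
    (hg : ∀ n z z', (∀ i ≤ n, z i = z' i) → g z n = g z' n)
    (hZ : ∀ z, (∀ n, ∃ z' ∈ Z, ∀ i < n, z' i = z i) → z ∈ Z)
    (hB : μ (g '' Z) = 1) (ε : ℝ) (hε : 0 < ε) :
    ∃ A : Set Cantor, IsClosed A ∧ 1 - ε < μ.real A ∧ ∃ h : Cantor → ℕ → ℕ,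
      (∀ n, IsLocallyConstant (fun x : A => h x n)) ∧ ∀ x ∈ A, h x ∈ Z ∧ g (h x) = x := by
  classical
  let B : List ℕ → Set Cantor := fun σ => g '' {z | z ∈ Z ∧ pref z σ.length = σ}
  let C : List ℕ → Set Cantor := fun σ =>
    {x | ∃ z ∈ Z, pref z σ.length = σ ∧ ∀ i < σ.length, g z i = x i}
  let H : List ℕ → Set Cantor := fun σ => toMeasurable μ (B σ) ∩ C σ
  have hCm : ∀ σ, MeasurableSet (C σ) := by
    intro σ
    refine (isClosed_of_dep _ σ.length ?_).measurableSet
    rintro x x' h ⟨z, h1, h2, h3⟩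
    exact ⟨z, h1, h2, fun i hi => (h3 i hi).trans (h i hi)⟩
  have hHm : ∀ σ, MeasurableSet (H σ) := fun σ => (measurableSet_toMeasurable _ _).inter (hCm σ)
  have hBH : ∀ σ, B σ ⊆ H σ := by
    intro σ x hx
    refine ⟨subset_toMeasurable _ _ hx, ?_⟩
    obtain ⟨z, ⟨h1, h2⟩, rfl⟩ := hx
    exact ⟨z, h1, h2, fun _ _ => rfl⟩
  have hnull : ∀ σ (H' : Set Cantor), MeasurableSet H' → B σ ⊆ H' → μ (H σ \ H') = 0 := by
    intro σ H' hm hs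
    have h1 : μ (toMeasurable μ (B σ) \ H') = 0 := by
      have h2 := measure_inter_add_sdiff (μ := μ) (toMeasurable μ (B σ)) hm
      have h3 : μ (toMeasurable μ (B σ)) ≤ μ (toMeasurable μ (B σ) ∩ H') := by
        rw [measure_toMeasurable]
        exact measure_mono (Set.subset_inter (subset_toMeasurable _ _) hs)
      have h4 : μ (toMeasurable μ (B σ) ∩ H') + μ (toMeasurable μ (B σ) \ H') ≤
          μ (toMeasurable μ (B σ) ∩ H') + 0 := by rw [h2, add_zero]; exact h3
      exact le_zero_iff.1 ((ENNReal.add_le_add_iff_left (measure_ne_top _ _)).1 h4)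
    exact measure_mono_null (Set.sdiff_subset_sdiff_left Set.inter_subset_left) h1
  have hBsplit : ∀ σ, B σ ⊆ ⋃ a, H (σ ++ [a]) := by
    rintro σ x ⟨z, ⟨h1, h2⟩, rfl⟩
    refine Set.mem_iUnion.2 ⟨z σ.length, hBH _ ⟨z, ⟨h1, ?_⟩, rfl⟩⟩
    rw [List.length_append, List.length_singleton, pref_succ, h2]
  let X0 : Set Cantor := H [] \ ⋃ σ, (H σ \ ⋃ a, H (σ ++ [a]))
  have hX0m : MeasurableSet X0 := (hHm []).diff
    (MeasurableSet.iUnion fun σ => (hHm σ).diff (MeasurableSet.iUnion fun a => hHm _))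
  have hX0 : μ X0 = 1 := by
    rw [measure_sdiff_null]
    · refine le_antisymm prob_le_one ?_
      rw [← hB]
      refine measure_mono (subset_trans ?_ (hBH []))
      rintro _ ⟨z, hz, rfl⟩
      exact ⟨z, ⟨hz, rfl⟩, rfl⟩
    · rw [measure_iUnion_null_iff]
      intro σ
      exact hnull σ _ (MeasurableSet.iUnion fun a => hHm _) (hBsplit σ)
  have hp : ∀ (σ : List ℕ) (x : Cantor), ∃ a, x ∈ H (σ ++ [a]) ∨ ∀ b, x ∉ H (σ ++ [b]) := by
    intro σ x
    by_cases h : ∃ a, x ∈ H (σ ++ [a])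
    · obtain ⟨a, ha⟩ := h; exact ⟨a, Or.inl ha⟩
    · push Not at h; exact ⟨0, Or.inr h⟩
  let nxt : Cantor → List ℕ → ℕ := fun x σ => Nat.find (hp σ x)
  have hnxt : ∀ σ x, (∃ a, x ∈ H (σ ++ [a])) → x ∈ H (σ ++ [nxt x σ]) := by
    rintro σ x ⟨a, ha⟩
    rcases Nat.find_spec (hp σ x) with h | h
    · exact h
    · exact absurd ha (h a)
  have hnxtm : ∀ σ, Measurable (fun x => nxt x σ) := by
    intro σ
    refine measurable_find (hp σ) ?_
    intro k
    have : {x | x ∈ H (σ ++ [k]) ∨ ∀ b, x ∉ H (σ ++ [b])} =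
        H (σ ++ [k]) ∪ ⋂ b, (H (σ ++ [b]))ᶜ := by
      ext x; simp
    rw [this]
    exact (hHm _).union (MeasurableSet.iInter fun b => (hHm _).compl)
  let sg : Cantor → ℕ → List ℕ := fun x n => Nat.rec [] (fun _ l => l ++ [nxt x l]) n
  have sgS : ∀ x n, sg x (n + 1) = sg x n ++ [nxt x (sg x n)] := fun _ _ => rfl
  let h : Cantor → ℕ → ℕ := fun x n => nxt x (sg x n)
  have hsg : ∀ x n, sg x n = pref (h x) n := by
    intro x n
    induction n with
    | zero => rfl
    | succ n ih => rw [sgS, pref_succ, ← ih]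
  have hsgm : ∀ n (σ : List ℕ), MeasurableSet {x | sg x n = σ} := by
    intro n
    induction n with
    | zero => intro σ; exact MeasurableSet.const ([] = σ)
    | succ n ih =>
      intro σ
      have : {x | sg x (n + 1) = σ} = ⋃ ρ : List ℕ, {x | sg x n = ρ} ∩
          (fun x => nxt x ρ) ⁻¹' {a | ρ ++ [a] = σ} := by
        ext x; simp [sgS]
      rw [this]
      exact MeasurableSet.iUnion fun ρ => (ih ρ).inter (hnxtm ρ (MeasurableSet.of_discrete))
  have hhm : ∀ n a, MeasurableSet {x | h x n = a} := by
    intro n a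
    have : {x | h x n = a} = ⋃ ρ : List ℕ, {x | sg x n = ρ} ∩ (fun x => nxt x ρ) ⁻¹' {a} := by
      ext x; simp [h]
    rw [this]
    exact MeasurableSet.iUnion fun ρ => (hsgm n ρ).inter (hnxtm ρ (MeasurableSet.of_discrete))
  have hgood : ∀ x ∈ X0, ∀ n, x ∈ H (sg x n) := by
    intro x hx n
    induction n with
    | zero => exact hx.1
    | succ n ih =>
      rw [sgS]
      apply hnxt
      by_contra hcon
      refine hx.2 (Set.mem_iUnion.2 ⟨sg x n, ih, ?_⟩)
      simpa using hcon
  have hsel : ∀ x ∈ X0, h x ∈ Z ∧ g (h x) = x := by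
    intro x hx
    have key : ∀ n, ∃ z ∈ Z, (∀ i < n, z i = h x i) ∧ ∀ i < n, g z i = x i := by
      intro n
      obtain ⟨z, h1, h2, h3⟩ := (hgood x hx n).2
      rw [hsg, pref_length] at h2 h3
      exact ⟨z, h1, (pref_eq_iff _ _ _).1 h2, h3⟩
    refine ⟨hZ _ fun n => ?_, ?_⟩
    · obtain ⟨z, h1, h2, _⟩ := key n
      exact ⟨z, h1, h2⟩
    · funext n
      obtain ⟨z, _, h2, h3⟩ := key (n + 1)
      rw [← h3 n (Nat.lt_succ_self n)]
      exact hg n _ _ fun i hi => (h2 i (Nat.lt_succ_of_le hi)).symm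
  -- Lusin
  have hε' : ENNReal.ofReal (ε / 2) ≠ 0 := by simp [hε]
  obtain ⟨δ, hδ0, hδ⟩ := ENNReal.exists_pos_sum_of_countable hε' (ℕ × ℕ)
  have hU : ∀ q : ℕ × ℕ, ∃ U : Set Cantor, {x | h x q.1 = q.2} ⊆ U ∧ IsOpen U ∧
      μ (U \ {x | h x q.1 = q.2}) < δ q := by
    intro q
    obtain ⟨U, h1, h2, _, h3⟩ := (hhm q.1 q.2).exists_isOpen_sdiff_lt (μ := μ)
      (measure_ne_top _ _) (ε := δ q) (by exact_mod_cast (hδ0 q).ne')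
    exact ⟨U, h1, h2, h3⟩
  choose U hU1 hU2 hU3 using hU
  let V : Set Cantor := ⋃ q, (U q \ {x | h x q.1 = q.2})
  have hVm : MeasurableSet V :=
    MeasurableSet.iUnion fun q => (hU2 q).measurableSet.diff (hhm _ _)
  have hV : μ.real V ≤ ε / 2 := by
    have : μ V ≤ ENNReal.ofReal (ε / 2) :=
      (measure_iUnion_le _).trans ((ENNReal.tsum_le_tsum fun q => (hU3 q).le).trans hδ.le)
    exact ENNReal.toReal_le_of_le_ofReal (by positivity) this
  obtain ⟨A, hA1, hA2, hA3⟩ := (hX0m.diff hVm).exists_isClosed_sdiff_lt (μ := μ)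
    (measure_ne_top _ _) hε'
  refine ⟨A, hA2, ?_, h, ?_, fun x hx => hsel x (hA1 hx).1⟩
  · have h1 : μ.real ((X0 \ V) \ A) < ε / 2 := by
      rw [Measure.real]
      exact (ENNReal.lt_ofReal_iff_toReal_lt (measure_ne_top _ _)).1 hA3
    rw [measureReal_sdiff hA1 hA2.measurableSet (measure_ne_top _ _)] at h1
    have h2 : μ.real X0 - μ.real V ≤ μ.real (X0 \ V) := le_measureReal_sdiff
    have h3 : μ.real X0 = 1 := by rw [Measure.real, hX0]; rfl
    linarith
  · intro n
    rw [IsLocallyConstant.iff_eventually_eq]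
    intro x
    have hx : (x : Cantor) ∈ U (n, h x n) := hU1 (n, h x n) rfl
    have : ∀ᶠ y : A in nhds x, (y : Cantor) ∈ U (n, h x n) :=
      continuous_subtype_val.continuousAt.eventually ((hU2 _).mem_nhds hx)
    filter_upwards [this] with y hy
    by_contra hne
    exact (hA1 y.2).2 (Set.mem_iUnion.2 ⟨(n, h x n), hy, hne⟩)

/-! ## Player II has a winning strategy -/

/-- the run where II follows `τ` and I plays `z` -/
def runII (τ : StratIIU) (z : ℕ → ℚ × ℚ) : RunU :=
  mkRun fun h => (z h.length, τ h (z h.length))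

theorem runII_eq (τ : StratIIU) (z : ℕ → ℚ × ℚ) (n : ℕ) :
    runII τ z n = (z n, τ (histU (runII τ z) n) (z n)) := by
  have := mkRun_eq (fun h => ((z h.length, τ h (z h.length)) : GRoundU)) n
  rw [pref_length] at this
  exact this

theorem cons_runII (τ : StratIIU) (z : ℕ → ℚ × ℚ) : ConsIIU τ (runII τ z) := fun n => by
  rw [runII_eq]

theorem runII_unique (τ : StratIIU) (r r' : RunU) (h : ConsIIU τ r) (h' : ConsIIU τ r') (n : ℕ)
    (hz : ∀ i < n, (r i).1 = (r' i).1) : ∀ i < n, r i = r' i := by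
  induction n with
  | zero => intro i hi; omega
  | succ n ih =>
    have ih' := ih fun i hi => hz i (by omega)
    intro i hi
    rcases Nat.lt_succ_iff_lt_or_eq.1 hi with hi | rfl
    · exact ih' i hi
    · have e : histU r i = histU r' i := (pref_eq_iff r r' i).2 ih'
      refine Prod.ext (hz i hi) ?_
      rw [h i, h' i, e, hz i hi]

theorem IOKU_congr (μ : Measure Cantor) (s : ℝ) (r r' : RunU) (n : ℕ)
    (h : ∀ i < n + 1, r i = r' i) (hr : IOKU μ s r n) : IOKU μ s r' n := by
  have hv : ∀ b, valIU r' n b = valIU r n b := fun b => by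
    rw [valIU, valIU, h n (Nat.lt_succ_self n)]
  have hp : pathU r' n = pathU r n :=
    (pref_eq_iff _ _ n).2 fun i hi => by rw [bitsU, bitsU, h i (by omega)]
  have hm : ∀ b, mOKU μ r n b → mOKU μ r' n b := fun b hb => by
    rw [mOKU, hv, hp]; exact hb
  cases n with
  | zero =>
    refine ⟨hm _ hr.1, hm _ hr.2.1, ?_⟩
    rw [← h 0 (by omega)]
    exact hr.2.2
  | succ n =>
    refine ⟨hm _ hr.1, hm _ hr.2.1, ?_⟩
    rw [← h (n + 1) (by omega), hr.2.2, selU, selU, valIU, valIU, bitsU, bitsU,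
      h n (by omega)]

def Inv (μ : Measure Cantor) (K : Set Cantor) (t : List Bool) (q : ℚ) : Prop :=
  0 ≤ q ∧ (q = 0 ∨ (q : ℝ) < μ.real (K ∩ cyl t))

theorem exists_split (μ : Measure Cantor) [IsProbabilityMeasure μ] (K : Set Cantor)
    (hK : MeasurableSet K) (t : List Bool) (q : ℚ) :
    ∃ m : ℚ × ℚ, Inv μ K t q → m.1 + m.2 = q ∧ Inv μ K (t ++ [false]) m.1 ∧
      Inv μ K (t ++ [true]) m.2 := by
  by_cases h : Inv μ K t q
  swap
  · exact ⟨(0, 0), fun h' => absurd h' h⟩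
  obtain ⟨h0, h1⟩ := h
  rcases h0.eq_or_lt with h0 | h0
  · exact ⟨(0, 0), fun _ => ⟨by simp [← h0], ⟨le_rfl, Or.inl rfl⟩, ⟨le_rfl, Or.inl rfl⟩⟩⟩
  have h1 : (q : ℝ) < μ.real (K ∩ cyl t) := h1.resolve_left h0.ne'
  rw [inter_cyl_split μ K hK t] at h1
  have ha : 0 ≤ μ.real (K ∩ cyl (t ++ [false])) := measureReal_nonneg
  have hb : 0 ≤ μ.real (K ∩ cyl (t ++ [true])) := measureReal_nonneg
  have h0' : (0 : ℝ) < q := by exact_mod_cast h0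
  rcases ha.eq_or_lt with ha | ha
  · exact ⟨(0, q), fun _ => ⟨by simp, ⟨le_rfl, Or.inl rfl⟩, ⟨h0.le, Or.inr (by linarith)⟩⟩⟩
  rcases hb.eq_or_lt with hb | hb
  · exact ⟨(q, 0), fun _ => ⟨by simp, ⟨h0.le, Or.inr (by linarith)⟩, ⟨le_rfl, Or.inl rfl⟩⟩⟩
  obtain ⟨m, hm1, hm2⟩ := exists_rat_btwn (show max 0 ((q : ℝ) - μ.real (K ∩ cyl (t ++ [true]))) <
    min (μ.real (K ∩ cyl (t ++ [false]))) q by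
      simp only [max_lt_iff, lt_min_iff]
      refine ⟨⟨?_, ?_⟩, ?_, ?_⟩ <;> linarith)
  simp only [max_lt_iff, lt_min_iff] at hm1 hm2
  refine ⟨(m, q - m), fun _ => ⟨by simp, ⟨?_, Or.inr hm2.1⟩, ⟨?_, Or.inr ?_⟩⟩⟩
  · exact_mod_cast hm1.1.le
  · have : m < q := by exact_mod_cast hm2.2
    simp only [sub_nonneg]; exact this.le
  · push_cast; linarith [hm1.2]

def qof (q0 : ℚ) (h : List GRoundU) : ℚ :=
  match h.getLast? with
  | none => q0
  | some r => vl r.1 r.2.1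

/-- Against a winning strategy of II, every closed set of positive measure is hit. -/
theorem hit (μ : Measure Cantor) [IsProbabilityMeasure μ] (R : Set (Cantor × Baire))
    (τ : StratIIU) (hτ : ∀ r : RunU, ConsIIU τ r → IIWinsRunU μ 0 R r)
    (K : Set Cantor) (hK : IsClosed K) (hpos : 0 < μ.real K) :
    ∃ r : RunU, ConsIIU τ r ∧ (∀ n, IOKU μ 0 r n) ∧ bitsU r ∈ K := by
  choose spl hspl using exists_split μ K hK.measurableSet
  obtain ⟨q0, hq0, hq1⟩ := exists_rat_btwn hpos
  let S : List GRoundU → ℚ × ℚ := fun h => spl (h.map (fun a => a.2.1)) (qof q0 h)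
  let r : RunU := mkRun fun h => (S h, τ h (S h))
  have hr : ∀ n, r n = (S (histU r n), τ (histU r n) (S (histU r n))) :=
    fun n => mkRun_eq (fun h => ((S h, τ h (S h)) : GRoundU)) n
  have hcons : ConsIIU τ r := fun n => by rw [hr]
  have hpath : ∀ n, (histU r n).map (fun a => a.2.1) = pathU r n := fun n => pref_map _ r n
  have hq : ∀ n, qof q0 (histU r (n + 1)) = selU r n := by
    intro n
    have : histU r (n + 1) = histU r n ++ [r n] := pref_succ _ _
    rw [this]
    simp only [qof, List.getLast?_append, List.getLast?_singleton, Option.some_or]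
    rfl
  have hS : ∀ n, (r n).1 = spl (pathU r n) (qof q0 (histU r n)) := by
    intro n
    rw [← hpath, hr n]
  have hpS : ∀ n, pathU r (n + 1) = pathU r n ++ [bitsU r n] := fun n => pref_succ _ _
  have step : ∀ n, Inv μ K (pathU r n) (qof q0 (histU r n)) →
      (r n).1.1 + (r n).1.2 = qof q0 (histU r n) ∧
        ∀ b, Inv μ K (pathU r n ++ [b]) (valIU r n b) := by
    intro n h
    obtain ⟨h1, h2, h3⟩ := hspl _ _ h
    rw [← hS] at h1 h2 h3
    refine ⟨h1, fun b => ?_⟩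
    cases b
    · simpa [valIU] using h2
    · simpa [valIU] using h3
  have hinv : ∀ n, Inv μ K (pathU r n) (qof q0 (histU r n)) := by
    intro n
    induction n with
    | zero =>
      have e1 : pathU r 0 = [] := rfl
      have e2 : qof q0 (histU r 0) = q0 := rfl
      rw [e1, e2]
      refine ⟨by exact_mod_cast hq0.le, Or.inr ?_⟩
      rw [cyl_nil, Set.inter_univ]
      exact hq1
    | succ n ih =>
      rw [hq, hpS]
      exact (step n ih).2 _
  have hm : ∀ n b, mOKU μ r n b := by
    intro n b
    obtain ⟨h1, h2⟩ := (step n (hinv n)).2 b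
    have h3 : μ.real (K ∩ cyl (pathU r n ++ [b])) ≤ μ.real (cyl (pathU r n ++ [b])) :=
      measureReal_mono Set.inter_subset_right
    have h4 : 0 ≤ μ.real (cyl (pathU r n ++ [b])) := measureReal_nonneg
    simp only [Measure.real] at h2 h3 h4
    rcases h2 with h2 | h2
    · refine ⟨h1, ?_, ?_⟩
      · rw [h2]; simpa using h4
      · intro h; rw [h2]; simpa using h
    · exact ⟨h1, (h2.trans_le h3).le, fun _ => h2.trans_le h3⟩
  have hI : ∀ n, IOKU μ 0 r n := by
    intro n
    cases n with
    | zero =>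
      refine ⟨hm _ _, hm _ _, ?_⟩
      have h1 := (step 0 (hinv 0)).1
      have e2 : qof q0 (histU r 0) = q0 := rfl
      rw [e2] at h1
      rw [← h1] at hq0
      exact_mod_cast hq0
    | succ n =>
      refine ⟨hm _ _, hm _ _, ?_⟩
      rw [(step _ (hinv _)).1, hq]
  refine ⟨r, hcons, hI, ?_⟩
  rcases hτ r hcons with ⟨n, _, h⟩ | ⟨h, _⟩
  · exact absurd (hI n) h
  · refine closed_of_prefs K hK _ fun n => ?_
    have h1 := hinv (n + 1)
    rw [hq] at h1
    have h2 := h1.2.resolve_left (h n).2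
    have h3 : 0 < μ.real (K ∩ cyl (pathU r (n + 1))) :=
      lt_of_le_of_lt (by exact_mod_cast h1.1) h2
    have h4 : (K ∩ cyl (pathU r (n + 1))).Nonempty := by
      by_contra hne
      rw [Set.not_nonempty_iff_eq_empty] at hne
      rw [hne] at h3
      simp at h3
    obtain ⟨y, hy, hy'⟩ := h4
    refine ⟨y, hy, fun i hi => ?_⟩
    have h5 : y ∈ cyl (pref (bitsU r) (n + 1)) := hy'
    rw [mem_cyl_pref] at h5
    exact (h5 i (by omega)).symm

theorem count_prod (r : RunU) (k : ℕ → ℕ) (hk : StrictMono k)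
    (h : ∀ n, ((r n).2.2).isSome ↔ ∃ i, k i = n) (i : ℕ) :
    ((Finset.range (k i)).filter fun n => ((r n).2.2).isSome = true).card = i := by
  have : (Finset.range (k i)).filter (fun n => ((r n).2.2).isSome = true) =
      (Finset.range i).image k := by
    ext n
    simp only [Finset.mem_filter, Finset.mem_range, Finset.mem_image, h]
    constructor
    · rintro ⟨h1, j, rfl⟩
      exact ⟨j, hk.lt_iff_lt.1 h1, rfl⟩
    · rintro ⟨j, hj, rfl⟩
      exact ⟨hk hj, j, rfl⟩
  rw [this, Finset.card_image_of_injective _ hk.injective, Finset.card_range]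

theorem produces_congr (r : RunU) (y : Baire) (h : ProducesY r y) (i : ℕ) :
    ∃ N, ∀ r' y', ProducesY r' y' → (∀ m < N, r m = r' m) → y' i = y i := by
  obtain ⟨k, hk1, hk2, hk3⟩ := h
  refine ⟨k i + 1, ?_⟩
  rintro r' y' ⟨k', hk1', hk2', hk3'⟩ hr
  have e := hr (k i) (Nat.lt_succ_self _)
  obtain ⟨j, hj⟩ := (hk2' (k i)).1 (by rw [← e]; exact (hk2 _).2 ⟨i, rfl⟩)
  have c1 := count_prod r k hk1 hk2 i
  have c2 := count_prod r' k' hk1' hk2' j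
  rw [hj] at c2
  have : (Finset.range (k i)).filter (fun n => ((r n).2.2).isSome = true) =
      (Finset.range (k i)).filter (fun n => ((r' n).2.2).isSome = true) := by
    refine Finset.filter_congr fun n hn => ?_
    rw [hr n (by have := Finset.mem_range.1 hn; omega)]
  rw [this, c2] at c1
  subst c1
  have h1 := hk3 j
  have h2 := hk3' j
  rw [hj, ← e, h1] at h2
  exact (Option.some.inj h2).symm

theorem winsII_uniformization (μ : Measure Cantor) [IsProbabilityMeasure μ]
    (R : Set (Cantor × Baire)) (h : WinsIIU μ 0 R) :
    ∀ ε : ℝ, 0 < ε → ∃ A : Set Cantor, IsClosed A ∧ 1 - ε < (μ A).toReal ∧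
      ∃ f : A → Baire, Continuous f ∧ ∀ x : A, ((x : Cantor), f x) ∈ R := by
  obtain ⟨τ, hτ⟩ := h
  intro ε hε
  obtain ⟨e, he⟩ := exists_surjective_nat (ℚ × ℚ)
  let rn : (ℕ → ℕ) → RunU := fun z => runII τ (fun i => e (z i))
  have rn1 : ∀ z n, (rn z n).1 = e (z n) := fun z n => by simp only [rn]; rw [runII_eq]
  have rnc : ∀ z, ConsIIU τ (rn z) := fun z => cons_runII _ _
  have rn_congr : ∀ n z z', (∀ i < n, z i = z' i) → ∀ i < n, rn z i = rn z' i := by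
    intro n z z' h
    refine runII_unique τ _ _ (rnc z) (rnc z') n fun i hi => ?_
    rw [rn1, rn1, h i hi]
  let Z : Set (ℕ → ℕ) := {z | ∀ n, IOKU μ 0 (rn z) n}
  let g : (ℕ → ℕ) → Cantor := fun z => bitsU (rn z)
  have hg : ∀ n z z', (∀ i ≤ n, z i = z' i) → g z n = g z' n := by
    intro n z z' h
    simp only [g, bitsU]
    rw [rn_congr (n + 1) z z' (fun i hi => h i (by omega)) n (by omega)]
  have hZ : ∀ z, (∀ n, ∃ z' ∈ Z, ∀ i < n, z' i = z i) → z ∈ Z := by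
    intro z h n
    obtain ⟨z', h1, h2⟩ := h (n + 1)
    exact IOKU_congr μ 0 (rn z') (rn z) n (rn_congr _ _ _ h2) (h1 n)
  have hB : μ (g '' Z) = 1 := by
    by_contra hne
    have hT := measurableSet_toMeasurable μ (g '' Z)
    have h1 : μ (toMeasurable μ (g '' Z))ᶜ ≠ 0 := by
      intro h0
      rw [prob_compl_eq_zero_iff hT, measure_toMeasurable] at h0
      exact hne h0
    obtain ⟨K, hK1, hK2, hK3⟩ := hT.compl.exists_lt_isCompact (pos_iff_ne_zero.2 h1)
    obtain ⟨r, hr1, hr2, hr3⟩ := hit μ R τ hτ K hK2.isClosed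
      (ENNReal.toReal_pos hK3.ne' (measure_ne_top _ _))
    choose z hz using fun n => he (r n).1
    have hrz : rn z = r := by
      funext n
      exact runII_unique τ _ _ (rnc z) hr1 (n + 1) (fun i _ => by rw [rn1, hz]) n (by omega)
    refine hK1 hr3 (subset_toMeasurable _ _ ⟨z, ?_, ?_⟩)
    · change ∀ n, IOKU μ 0 (rn z) n
      rw [hrz]; exact hr2
    · simp only [g, hrz]
  obtain ⟨A, hA1, hA2, hh, hA3, hA4⟩ := selection μ Z g hg hZ hB ε hε
  refine ⟨A, hA1, hA2, ?_⟩
  have hy : ∀ x : A, ∃ y, ProducesY (rn (hh x)) y ∧ ((x : Cantor), y) ∈ R := by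
    intro x
    obtain ⟨h1, h2⟩ := hA4 x x.2
    rcases hτ _ (rnc (hh x)) with ⟨n, _, h⟩ | ⟨_, y, h3, h4⟩
    · exact absurd (h1 n) h
    · refine ⟨y, h3, ?_⟩
      have h2' : bitsU (rn (hh x)) = x := h2
      rw [← h2']; exact h4
  choose f hf1 hf2 using hy
  refine ⟨f, ?_, hf2⟩
  refine continuous_pi fun i => ?_
  refine IsLocallyConstant.continuous ?_
  rw [IsLocallyConstant.iff_eventually_eq]
  intro x
  obtain ⟨N, hN⟩ := produces_congr _ _ (hf1 x) i
  have hev : ∀ᶠ x' : A in nhds x, ∀ m ∈ Finset.range N, hh x' m = hh x m := by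
    rw [Filter.eventually_all_finset]
    intro m _
    exact (IsLocallyConstant.iff_eventually_eq _).1 (hA3 m) x
  filter_upwards [hev] with x' hx'
  refine hN _ _ (hf1 x') (rn_congr N _ _ fun m hm => ?_)
  exact (hx' m (Finset.mem_range.2 hm)).symm

/-- Continuous uniformization on a set of large measure: if `R ⊆ 2^ω × ω^ω` has full domain
and the unfolded game `G_unfolded(0, R)` is determined, then for every `ε > 0` there is a
closed set `A` with `μ(A) > 1 - ε` and a continuous `f : A → ω^ω` uniformizing `R` on `A`. -/
theorem continuous_uniformization (μ : Measure Cantor) [IsProbabilityMeasure μ]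
    (R : Set (Cantor × Baire)) (htotal : ∀ x : Cantor, ∃ y : Baire, (x, y) ∈ R)
    (hdet : WinsIU μ 0 R ∨ WinsIIU μ 0 R) :
    ∀ ε : ℝ, 0 < ε → ∃ A : Set Cantor, IsClosed A ∧ 1 - ε < (μ A).toReal ∧
      ∃ f : A → Baire, Continuous f ∧ ∀ x : A, ((x : Cantor), f x) ∈ R := by
  rcases hdet with h | h
  · exact absurd h (not_winsI μ R htotal)
  · exact winsII_uniformization μ R h

end MeasureGame
end
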